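/- Over an algebraically closed field k of characteristic ≠ 2,3,5, the field K of GL_2(k)-invariant rational functions in k(A_0,...,A_6) (the function field of the space of binary sextics) is the rational function field k(T_1, T_2, T_3), where T_1 = I_4/I_2^2, T_2 = I_6/I_2^3, T_3 = I_10/I_2^5. -/

import Mathlib

open MvPolynomial
noncomputable section

/-- The binary form of degree `d` with coefficient vector `a`. -/
def toForm (k : Type*) [CommSemiring k] (d : ℕ) (a : Fin (d+1) → k) :
    MvPolynomial (Fin 2) k :=
  ∑ i : Fin (d+1), C (a i) * X 0 ^ (d - (i : ℕ)) * X 1 ^ (i : ℕ)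

/-- Coordinate change by the matrix `g` : `X ↦ g00 X + g01 Y`, `Y ↦ g10 X + g11 Y`. -/
def matAct (k : Type*) [CommSemiring k] (g : Matrix (Fin 2) (Fin 2) k)
    (p : MvPolynomial (Fin 2) k) : MvPolynomial (Fin 2) k :=
  aeval (fun j : Fin 2 => C (g j 0) * X 0 + C (g j 1) * X 1) p

/-- The coefficient of `X^(d-i) Y^i` in a binary form of degree `d`. -/
def formCoeff (k : Type*) [CommSemiring k] (d : ℕ) (p : MvPolynomial (Fin 2) k)
    (i : Fin (d+1)) : k :=
  coeff (Finsupp.single 0 (d - (i : ℕ)) + Finsupp.single 1 (i : ℕ)) p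

/-- The induced action of a `2×2` matrix on the coefficient vector of a binary form. -/
def actCoeff (k : Type*) [CommSemiring k] (d : ℕ) (g : Matrix (Fin 2) (Fin 2) k)
    (a : Fin (d+1) → k) : Fin (d+1) → k :=
  formCoeff k d (matAct k g (toForm k d a))

/-- `P ∈ k[A_0,…,A_d]` is an `SL₂(k)`-invariant. -/
def SL2Invariant (k : Type*) [CommRing k] (d : ℕ)
    (P : MvPolynomial (Fin (d+1)) k) : Prop :=
  ∀ g : Matrix.SpecialLinearGroup (Fin 2) k, ∀ a : Fin (d+1) → k,
    eval (actCoeff k d (g : Matrix (Fin 2) (Fin 2) k) a) P = eval a P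

/-- The ring `R_d` of `SL₂(k)`-invariants in `k[A_0,…,A_d]`. -/
def Rd (k : Type*) [Field k] (d : ℕ) : Subalgebra k (MvPolynomial (Fin (d+1)) k) where
  carrier := {P | SL2Invariant k d P}
  mul_mem' := fun hP hQ g a => by simp only [map_mul]; rw [hP g a, hQ g a]
  add_mem' := fun hP hQ g a => by simp only [map_add]; rw [hP g a, hQ g a]
  algebraMap_mem' := fun r g a => by simp [SL2Invariant]
open scoped Classical

/-- `D_{ij} = x_i y_j - x_j y_i` for the roots `(x_i , y_i)` of a binary sextic. -/
def Dij {k : Type*} [CommRing k] (x y : Fin 6 → k) (i j : Fin 6) : k :=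
  x i * y j - x j * y i

/-- `Σ D_{ij}² D_{kl}² D_{mn}²`, the sum running over the 15 partitions of `{1,…,6}`
into three pairs (each partition counted 48 times by permutations). -/
def sumPairs {k : Type*} [Field k] (x y : Fin 6 → k) : k :=
  (48 : k)⁻¹ * ∑ σ : Equiv.Perm (Fin 6),
    (Dij x y (σ 0) (σ 1))^2 * (Dij x y (σ 2) (σ 3))^2 * (Dij x y (σ 4) (σ 5))^2

/-- `Σ D_{ij}² D_{jk}² D_{ki}² D_{lm}² D_{mn}² D_{nl}²`, the sum running over the
10 partitions of `{1,…,6}` into two 3-sets (each counted 72 times by permutations). -/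
def sumB {k : Type*} [Field k] (x y : Fin 6 → k) : k :=
  (72 : k)⁻¹ * ∑ σ : Equiv.Perm (Fin 6),
    ((Dij x y (σ 0) (σ 1))^2 * (Dij x y (σ 1) (σ 2))^2 * (Dij x y (σ 2) (σ 0))^2)
    * ((Dij x y (σ 3) (σ 4))^2 * (Dij x y (σ 4) (σ 5))^2 * (Dij x y (σ 5) (σ 3))^2)

/-- The 60-term sum over pairs of matched triangles (each matched configuration
counted 12 times by permutations). -/
def sumC {k : Type*} [Field k] (x y : Fin 6 → k) : k :=
  (12 : k)⁻¹ * ∑ σ : Equiv.Perm (Fin 6),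
    ((Dij x y (σ 0) (σ 1))^2 * (Dij x y (σ 1) (σ 2))^2 * (Dij x y (σ 2) (σ 0))^2)
    * ((Dij x y (σ 3) (σ 4))^2 * (Dij x y (σ 4) (σ 5))^2 * (Dij x y (σ 5) (σ 3))^2)
    * ((Dij x y (σ 0) (σ 3))^2 * (Dij x y (σ 1) (σ 4))^2 * (Dij x y (σ 2) (σ 5))^2)

/-- The basic invariant `I₂` of a binary sextic, expressed through the roots, in the
normalization used by the paper's coefficient formulas. -/
def I2r {k : Type*} [Field k] (x y : Fin 6 → k) : k :=
  -(2 : k)⁻¹ * sumPairs x y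

/-- The basic invariant `I₄` (`= 4I₂² - B` in the paper's normalization of `B`),
expressed through the roots. -/
def I4r {k : Type*} [Field k] (x y : Fin 6 → k) : k :=
  9 * (I2r x y)^2 - 80 * sumB x y

/-- The basic invariant `I₆` (`= 8I₂³ - 160 I₂ I₄ - C` in the paper's normalization
of `C`), expressed through the roots. -/
def I6r {k : Type*} [Field k] (x y : Fin 6 → k) : k :=
  (13/108 : k) * (I2r x y)^3 - (1/108 : k) * I2r x y * I4r x y + (25/9 : k) * sumC x y

/-- The discriminant `I₁₀ = ∏_{i<j} D_{ij}²`. -/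
def I10r {k : Type*} [Field k] (x y : Fin 6 → k) : k :=
  ∏ p ∈ Finset.univ.filter (fun p : Fin 6 × Fin 6 => p.1 < p.2), (Dij x y p.1 p.2)^2

/-- The coefficient of `X^(6-j) Y^j` in the sextic `∏ (y_i X - x_i Y)`. -/
def sexticCoeff {k : Type*} [Field k] (x y : Fin 6 → k) (j : Fin 7) : k :=
  formCoeff k 6 (∏ i : Fin 6,
    (MvPolynomial.C (y i) * MvPolynomial.X 0 - MvPolynomial.C (x i) * MvPolynomial.X 1)) j

/-- The multiplicity of the `i`-th root among the six roots of the sextic. -/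
def rootMult {k : Type*} [Field k] (x y : Fin 6 → k) (i : Fin 6) : ℕ :=
  (Finset.univ.filter (fun j => x i * y j = x j * y i)).card
/-- The induced action of a matrix on the coordinate ring `k[A_0,…,A_d]`:
`(P^g)(f) = P(g·f)`. -/
def actRing (k : Type*) [CommRing k] (d : ℕ) (g : Matrix (Fin 2) (Fin 2) k) :
    MvPolynomial (Fin (d+1)) k →ₐ[k] MvPolynomial (Fin (d+1)) k :=
  aeval (actCoeff (MvPolynomial (Fin (d+1)) k) d
    (g.map MvPolynomial.C) MvPolynomial.X)
/-- A rational function in the coefficients of a binary sextic is `GL₂(k)`-invariant. -/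
def RatInvariant (k : Type*) [Field k]
    (u : FractionRing (MvPolynomial (Fin 7) k)) : Prop :=
  ∀ g : GL (Fin 2) k, ∀ p q : MvPolynomial (Fin 7) k,
    u * algebraMap (MvPolynomial (Fin 7) k) (FractionRing (MvPolynomial (Fin 7) k)) q
        = algebraMap (MvPolynomial (Fin 7) k) (FractionRing (MvPolynomial (Fin 7) k)) p →
    u * algebraMap (MvPolynomial (Fin 7) k) (FractionRing (MvPolynomial (Fin 7) k))
          (actRing k 6 (g : Matrix (Fin 2) (Fin 2) k) q)
        = algebraMap (MvPolynomial (Fin 7) k) (FractionRing (MvPolynomial (Fin 7) k))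
          (actRing k 6 (g : Matrix (Fin 2) (Fin 2) k) p)


open Equiv.Perm in
theorem perm6sum {k : Type*} [AddCommMonoid k] (G : Equiv.Perm (Fin 6) → k) : ∑ σ, G σ = ∑ a : Fin 6, ∑ b : Fin 5, ∑ c : Fin 4, ∑ d : Fin 3, ∑ f : Fin 2,
     G (decomposeFin.symm (a, decomposeFin.symm (b, decomposeFin.symm (c, decomposeFin.symm (d, decomposeFin.symm (f, 1)))))) := by
    simp only [Finset.univ_perm_fin_succ, ← Finset.univ_product_univ, Finset.sum_map, Finset.sum_product, Equiv.toEmbedding_apply]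
    simp
theorem perm6sum' {k : Type*} [AddCommMonoid k] (G : Fin 6 → Fin 6 → Fin 6 → Fin 6 → Fin 6 → Fin 6 → k) :
   ∑ σ : Equiv.Perm (Fin 6), G (σ 0) (σ 1) (σ 2) (σ 3) (σ 4) (σ 5) = 
   ∑ a : Fin 6, ∑ b : Fin 5, ∑ c : Fin 4, ∑ d : Fin 3, ∑ f : Fin 2,
     G a (Equiv.swap 0 a b.succ) (Equiv.swap 0 a (Equiv.swap 0 b c.succ).succ) 
      (Equiv.swap 0 a (Equiv.swap 0 b (Equiv.swap 0 c d.succ).succ).succ)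
      (Equiv.swap 0 a (Equiv.swap 0 b (Equiv.swap 0 c (Equiv.swap 0 d f.succ).succ).succ).succ)
      (Equiv.swap 0 a (Equiv.swap 0 b (Equiv.swap 0 c (Equiv.swap 0 d (Equiv.swap 0 f 1).succ).succ).succ).succ) := by
  rw [perm6sum]
  refine Finset.sum_congr rfl fun a _ => Finset.sum_congr rfl fun b _ => Finset.sum_congr rfl fun c _ => Finset.sum_congr rfl fun d _ => Finset.sum_congr rfl fun f _ => ?_
  have h1 : (1 : Fin 6) = Fin.succ 0 := rfl
  have h2 : (2 : Fin 6) = Fin.succ (Fin.succ 0) := rfl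
  have h3 : (3 : Fin 6) = Fin.succ (Fin.succ (Fin.succ 0)) := rfl
  have h4 : (4 : Fin 6) = Fin.succ (Fin.succ (Fin.succ (Fin.succ 0))) := rfl
  have h5 : (5 : Fin 6) = Fin.succ (Fin.succ (Fin.succ (Fin.succ (Fin.succ 0)))) := rfl
  have h6 : (1 : Fin 2) = Fin.succ 0 := rfl
  rw [h1, h2, h3, h4, h5, h6]
  simp only [Equiv.Perm.decomposeFin_symm_apply_succ, Equiv.Perm.decomposeFin_symm_apply_zero, Equiv.Perm.one_apply]

set_option maxHeartbeats 4000000 in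
set_option maxRecDepth 100000 in
theorem perm_pairs {k : Type*} [Field k] (e : Fin 6 → Fin 6 → k)
    (he : ∀ i j, e i j = e j i) :
    (∑ σ : Equiv.Perm (Fin 6), e (σ 0) (σ 1) * e (σ 2) (σ 3) * e (σ 4) (σ 5)) =
    48 * (e 0 1*e 2 3*e 4 5 + e 0 5*e 1 2*e 3 4 + e 0 4*e 1 3*e 2 5 + e 0 3*e 1 5*e 2 4 + e 0 2*e 1
      4*e 3 5 + e 0 3*e 1 4*e 2 5 + e 0 2*e 1 5*e 3 4 + e 0 4*e 1 2*e 3 5 + e 0 5*e 1 3*e 2 4 +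
      e 0 1*e 2 4*e 3 5 + e 0 2*e 1 3*e 4 5 + e 0 4*e 1 5*e 2 3 + e 0 5*e 1 4*e 2 3 + e 0 3*e 1
      2*e 4 5 + e 0 1*e 2 5*e 3 4) := by
  rw [perm6sum' (fun a b c d f g => e a b * e c d * e f g)]
  simp only [Fin.sum_univ_two, Fin.sum_univ_three, Fin.sum_univ_four, Fin.sum_univ_five,
    Fin.sum_univ_six, Equiv.swap_apply_def, Fin.isValue, Fin.reduceSucc, Fin.reduceEq, if_true,
    if_false]
  simp only [he 1 0, he 2 0, he 3 0, he 4 0, he 5 0, he 2 1, he 3 1, he 4 1, he 5 1, he 3 2,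
    he 4 2, he 5 2, he 4 3, he 5 3, he 5 4]
  ring

set_option maxHeartbeats 4000000 in
set_option maxRecDepth 100000 in
theorem perm_B {k : Type*} [Field k] (e : Fin 6 → Fin 6 → k)
    (he : ∀ i j, e i j = e j i) :
    (∑ σ : Equiv.Perm (Fin 6), (e (σ 0) (σ 1) * e (σ 1) (σ 2) * e (σ 2) (σ 0)) * (e (σ 3) (σ 4) * e (σ 4) (σ 5) * e (σ 5) (σ 3))) =
    72 * (e 0 1*e 1 2*e 0 2*(e 3 4*e 4 5*e 3 5) + e 0 1*e 1 3*e 0 3*(e 2 4*e 4 5*e 2 5) + e 0 1*e 1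
      4*e 0 4*(e 2 3*e 3 5*e 2 5) + e 0 1*e 1 5*e 0 5*(e 2 3*e 3 4*e 2 4) + e 0 2*e 2 3*e 0 3*(e
      1 4*e 4 5*e 1 5) + e 0 2*e 2 4*e 0 4*(e 1 3*e 3 5*e 1 5) + e 0 2*e 2 5*e 0 5*(e 1 3*e 3
      4*e 1 4) + e 0 3*e 3 4*e 0 4*(e 1 2*e 2 5*e 1 5) + e 0 3*e 3 5*e 0 5*(e 1 2*e 2 4*e 1 4) +
      e 0 4*e 4 5*e 0 5*(e 1 2*e 2 3*e 1 3)) := by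
  rw [perm6sum' (fun a b c d f g => (e a b * e b c * e c a) * (e d f * e f g * e g d))]
  simp only [Fin.sum_univ_two, Fin.sum_univ_three, Fin.sum_univ_four, Fin.sum_univ_five,
    Fin.sum_univ_six, Equiv.swap_apply_def, Fin.isValue, Fin.reduceSucc, Fin.reduceEq, if_true,
    if_false]
  simp only [he 1 0, he 2 0, he 3 0, he 4 0, he 5 0, he 2 1, he 3 1, he 4 1, he 5 1, he 3 2,
    he 4 2, he 5 2, he 4 3, he 5 3, he 5 4]
  ring

set_option maxHeartbeats 4000000 in
set_option maxRecDepth 100000 in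
theorem perm_C {k : Type*} [Field k] (e : Fin 6 → Fin 6 → k)
    (he : ∀ i j, e i j = e j i) :
    (∑ σ : Equiv.Perm (Fin 6), (e (σ 0) (σ 1) * e (σ 1) (σ 2) * e (σ 2) (σ 0)) * (e (σ 3) (σ 4) * e (σ 4) (σ 5) * e (σ 5) (σ 3)) * (e (σ 0) (σ 3) * e (σ 1) (σ 4) * e (σ 2) (σ 5))) =
    12 * ((e 0 1*e 2 3*e 4 5)*(e 0 5*e 1 2*e 3 4)*(e 0 4*e 1 3*e 2 5) + (e 0 1*e 2 3*e 4 5)*(e 0 5*e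
      1 2*e 3 4)*(e 0 3*e 1 5*e 2 4) + (e 0 1*e 2 3*e 4 5)*(e 0 5*e 1 2*e 3 4)*(e 0 2*e 1 4*e 3
      5) + (e 0 1*e 2 3*e 4 5)*(e 0 4*e 1 3*e 2 5)*(e 0 3*e 1 5*e 2 4) + (e 0 1*e 2 3*e 4 5)*(e
      0 4*e 1 3*e 2 5)*(e 0 2*e 1 4*e 3 5) + (e 0 1*e 2 3*e 4 5)*(e 0 3*e 1 5*e 2 4)*(e 0 2*e 1
      4*e 3 5) + (e 0 5*e 1 2*e 3 4)*(e 0 4*e 1 3*e 2 5)*(e 0 3*e 1 5*e 2 4) + (e 0 5*e 1 2*e 3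
      4)*(e 0 4*e 1 3*e 2 5)*(e 0 2*e 1 4*e 3 5) + (e 0 5*e 1 2*e 3 4)*(e 0 3*e 1 5*e 2 4)*(e 0
      2*e 1 4*e 3 5) + (e 0 4*e 1 3*e 2 5)*(e 0 3*e 1 5*e 2 4)*(e 0 2*e 1 4*e 3 5) + (e 0 1*e 2
      3*e 4 5)*(e 0 3*e 1 4*e 2 5)*(e 0 2*e 1 5*e 3 4) + (e 0 1*e 2 3*e 4 5)*(e 0 3*e 1 4*e 2
      5)*(e 0 4*e 1 2*e 3 5) + (e 0 1*e 2 3*e 4 5)*(e 0 3*e 1 4*e 2 5)*(e 0 5*e 1 3*e 2 4) + (e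
      0 1*e 2 3*e 4 5)*(e 0 2*e 1 5*e 3 4)*(e 0 4*e 1 2*e 3 5) + (e 0 1*e 2 3*e 4 5)*(e 0 2*e 1
      5*e 3 4)*(e 0 5*e 1 3*e 2 4) + (e 0 1*e 2 3*e 4 5)*(e 0 4*e 1 2*e 3 5)*(e 0 5*e 1 3*e 2 4)
      + (e 0 3*e 1 4*e 2 5)*(e 0 2*e 1 5*e 3 4)*(e 0 4*e 1 2*e 3 5) + (e 0 3*e 1 4*e 2 5)*(e 0
      2*e 1 5*e 3 4)*(e 0 5*e 1 3*e 2 4) + (e 0 3*e 1 4*e 2 5)*(e 0 4*e 1 2*e 3 5)*(e 0 5*e 1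
      3*e 2 4) + (e 0 2*e 1 5*e 3 4)*(e 0 4*e 1 2*e 3 5)*(e 0 5*e 1 3*e 2 4) + (e 0 5*e 1 2*e 3
      4)*(e 0 3*e 1 4*e 2 5)*(e 0 1*e 2 4*e 3 5) + (e 0 5*e 1 2*e 3 4)*(e 0 3*e 1 4*e 2 5)*(e 0
      2*e 1 3*e 4 5) + (e 0 5*e 1 2*e 3 4)*(e 0 3*e 1 4*e 2 5)*(e 0 4*e 1 5*e 2 3) + (e 0 5*e 1
      2*e 3 4)*(e 0 1*e 2 4*e 3 5)*(e 0 2*e 1 3*e 4 5) + (e 0 5*e 1 2*e 3 4)*(e 0 1*e 2 4*e 3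
      5)*(e 0 4*e 1 5*e 2 3) + (e 0 5*e 1 2*e 3 4)*(e 0 2*e 1 3*e 4 5)*(e 0 4*e 1 5*e 2 3) + (e
      0 3*e 1 4*e 2 5)*(e 0 1*e 2 4*e 3 5)*(e 0 2*e 1 3*e 4 5) + (e 0 3*e 1 4*e 2 5)*(e 0 1*e 2
      4*e 3 5)*(e 0 4*e 1 5*e 2 3) + (e 0 3*e 1 4*e 2 5)*(e 0 2*e 1 3*e 4 5)*(e 0 4*e 1 5*e 2 3)
      + (e 0 1*e 2 4*e 3 5)*(e 0 2*e 1 3*e 4 5)*(e 0 4*e 1 5*e 2 3) + (e 0 4*e 1 3*e 2 5)*(e 0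
      2*e 1 5*e 3 4)*(e 0 1*e 2 4*e 3 5) + (e 0 4*e 1 3*e 2 5)*(e 0 2*e 1 5*e 3 4)*(e 0 5*e 1
      4*e 2 3) + (e 0 4*e 1 3*e 2 5)*(e 0 2*e 1 5*e 3 4)*(e 0 3*e 1 2*e 4 5) + (e 0 4*e 1 3*e 2
      5)*(e 0 1*e 2 4*e 3 5)*(e 0 5*e 1 4*e 2 3) + (e 0 4*e 1 3*e 2 5)*(e 0 1*e 2 4*e 3 5)*(e 0
      3*e 1 2*e 4 5) + (e 0 4*e 1 3*e 2 5)*(e 0 5*e 1 4*e 2 3)*(e 0 3*e 1 2*e 4 5) + (e 0 2*e 1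
      5*e 3 4)*(e 0 1*e 2 4*e 3 5)*(e 0 5*e 1 4*e 2 3) + (e 0 2*e 1 5*e 3 4)*(e 0 1*e 2 4*e 3
      5)*(e 0 3*e 1 2*e 4 5) + (e 0 2*e 1 5*e 3 4)*(e 0 5*e 1 4*e 2 3)*(e 0 3*e 1 2*e 4 5) + (e
      0 1*e 2 4*e 3 5)*(e 0 5*e 1 4*e 2 3)*(e 0 3*e 1 2*e 4 5) + (e 0 3*e 1 5*e 2 4)*(e 0 4*e 1
      2*e 3 5)*(e 0 2*e 1 3*e 4 5) + (e 0 3*e 1 5*e 2 4)*(e 0 4*e 1 2*e 3 5)*(e 0 5*e 1 4*e 2 3)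
      + (e 0 3*e 1 5*e 2 4)*(e 0 4*e 1 2*e 3 5)*(e 0 1*e 2 5*e 3 4) + (e 0 3*e 1 5*e 2 4)*(e 0
      2*e 1 3*e 4 5)*(e 0 5*e 1 4*e 2 3) + (e 0 3*e 1 5*e 2 4)*(e 0 2*e 1 3*e 4 5)*(e 0 1*e 2
      5*e 3 4) + (e 0 3*e 1 5*e 2 4)*(e 0 5*e 1 4*e 2 3)*(e 0 1*e 2 5*e 3 4) + (e 0 4*e 1 2*e 3
      5)*(e 0 2*e 1 3*e 4 5)*(e 0 5*e 1 4*e 2 3) + (e 0 4*e 1 2*e 3 5)*(e 0 2*e 1 3*e 4 5)*(e 0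
      1*e 2 5*e 3 4) + (e 0 4*e 1 2*e 3 5)*(e 0 5*e 1 4*e 2 3)*(e 0 1*e 2 5*e 3 4) + (e 0 2*e 1
      3*e 4 5)*(e 0 5*e 1 4*e 2 3)*(e 0 1*e 2 5*e 3 4) + (e 0 2*e 1 4*e 3 5)*(e 0 5*e 1 3*e 2
      4)*(e 0 4*e 1 5*e 2 3) + (e 0 2*e 1 4*e 3 5)*(e 0 5*e 1 3*e 2 4)*(e 0 3*e 1 2*e 4 5) + (e
      0 2*e 1 4*e 3 5)*(e 0 5*e 1 3*e 2 4)*(e 0 1*e 2 5*e 3 4) + (e 0 2*e 1 4*e 3 5)*(e 0 4*e 1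
      5*e 2 3)*(e 0 3*e 1 2*e 4 5) + (e 0 2*e 1 4*e 3 5)*(e 0 4*e 1 5*e 2 3)*(e 0 1*e 2 5*e 3 4)
      + (e 0 2*e 1 4*e 3 5)*(e 0 3*e 1 2*e 4 5)*(e 0 1*e 2 5*e 3 4) + (e 0 5*e 1 3*e 2 4)*(e 0
      4*e 1 5*e 2 3)*(e 0 3*e 1 2*e 4 5) + (e 0 5*e 1 3*e 2 4)*(e 0 4*e 1 5*e 2 3)*(e 0 1*e 2
      5*e 3 4) + (e 0 5*e 1 3*e 2 4)*(e 0 3*e 1 2*e 4 5)*(e 0 1*e 2 5*e 3 4) + (e 0 4*e 1 5*e 2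
      3)*(e 0 3*e 1 2*e 4 5)*(e 0 1*e 2 5*e 3 4)) := by
  rw [perm6sum' (fun a b c d f g => (e a b * e b c * e c a) * (e d f * e f g * e g d) * (e a d * e b f * e c g))]
  simp only [Fin.sum_univ_two, Fin.sum_univ_three, Fin.sum_univ_four, Fin.sum_univ_five,
    Fin.sum_univ_six, Equiv.swap_apply_def, Fin.isValue, Fin.reduceSucc, Fin.reduceEq, if_true,
    if_false]
  simp only [he 1 0, he 2 0, he 3 0, he 4 0, he 5 0, he 2 1, he 3 1, he 4 1, he 5 1, he 3 2,
    he 4 2, he 5 2, he 4 3, he 5 3, he 5 4]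
  ring


/-- The six Joubert functions of six points of the projective line. -/
def xi {k : Type*} [CommRing k] (x y : Fin 6 → k) : Fin 6 → k :=
  ![Dij x y 0 1 * Dij x y 2 3 * Dij x y 4 5 + Dij x y 0 2 * Dij x y 1 4 * Dij x y 3 5 + Dij x y 0 3 * Dij x y 1 5 * Dij x y 2 4 + Dij x y 0 4 * Dij x y 1 3 * Dij x y 2 5 + Dij x y 0 5 * Dij x y 1 2 * Dij x y 3 4,
    Dij x y 0 1 * Dij x y 2 3 * Dij x y 4 5 - Dij x y 0 2 * Dij x y 1 5 * Dij x y 3 4 - Dij x y 0 3 * Dij x y 1 4 * Dij x y 2 5 - Dij x y 0 4 * Dij x y 1 2 * Dij x y 3 5 - Dij x y 0 5 * Dij x y 1 3 * Dij x y 2 4,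
    - Dij x y 0 1 * Dij x y 2 4 * Dij x y 3 5 - Dij x y 0 2 * Dij x y 1 3 * Dij x y 4 5 - Dij x y 0 3 * Dij x y 1 4 * Dij x y 2 5 - Dij x y 0 4 * Dij x y 1 5 * Dij x y 2 3 + Dij x y 0 5 * Dij x y 1 2 * Dij x y 3 4,
    - Dij x y 0 1 * Dij x y 2 4 * Dij x y 3 5 - Dij x y 0 2 * Dij x y 1 5 * Dij x y 3 4 + Dij x y 0 3 * Dij x y 1 2 * Dij x y 4 5 + Dij x y 0 4 * Dij x y 1 3 * Dij x y 2 5 + Dij x y 0 5 * Dij x y 1 4 * Dij x y 2 3,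
    Dij x y 0 1 * Dij x y 2 5 * Dij x y 3 4 - Dij x y 0 2 * Dij x y 1 3 * Dij x y 4 5 + Dij x y 0 3 * Dij x y 1 5 * Dij x y 2 4 - Dij x y 0 4 * Dij x y 1 2 * Dij x y 3 5 + Dij x y 0 5 * Dij x y 1 4 * Dij x y 2 3,
    Dij x y 0 1 * Dij x y 2 5 * Dij x y 3 4 + Dij x y 0 2 * Dij x y 1 4 * Dij x y 3 5 + Dij x y 0 3 * Dij x y 1 2 * Dij x y 4 5 - Dij x y 0 4 * Dij x y 1 5 * Dij x y 2 3 - Dij x y 0 5 * Dij x y 1 3 * Dij x y 2 4]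

theorem xi_add_01 {k : Type*} [CommRing k] (x y : Fin 6 → k) :
    xi x y 0 + xi x y 1 = 4 * (Dij x y 0 1 * Dij x y 2 3 * Dij x y 4 5) := by
  simp [xi, Dij]; ring

theorem xi_add_02 {k : Type*} [CommRing k] (x y : Fin 6 → k) :
    xi x y 0 + xi x y 2 = 4 * (Dij x y 0 5 * Dij x y 1 2 * Dij x y 3 4) := by
  simp [xi, Dij]; ring

theorem xi_add_03 {k : Type*} [CommRing k] (x y : Fin 6 → k) :
    xi x y 0 + xi x y 3 = 4 * (Dij x y 0 4 * Dij x y 1 3 * Dij x y 2 5) := by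
  simp [xi, Dij]; ring

theorem xi_add_04 {k : Type*} [CommRing k] (x y : Fin 6 → k) :
    xi x y 0 + xi x y 4 = 4 * (Dij x y 0 3 * Dij x y 1 5 * Dij x y 2 4) := by
  simp [xi, Dij]; ring

theorem xi_add_05 {k : Type*} [CommRing k] (x y : Fin 6 → k) :
    xi x y 0 + xi x y 5 = 4 * (Dij x y 0 2 * Dij x y 1 4 * Dij x y 3 5) := by
  simp [xi, Dij]; ring

theorem xi_add_12 {k : Type*} [CommRing k] (x y : Fin 6 → k) :
    xi x y 1 + xi x y 2 = -4 * (Dij x y 0 3 * Dij x y 1 4 * Dij x y 2 5) := by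
  simp [xi, Dij]; ring

theorem xi_add_13 {k : Type*} [CommRing k] (x y : Fin 6 → k) :
    xi x y 1 + xi x y 3 = -4 * (Dij x y 0 2 * Dij x y 1 5 * Dij x y 3 4) := by
  simp [xi, Dij]; ring

theorem xi_add_14 {k : Type*} [CommRing k] (x y : Fin 6 → k) :
    xi x y 1 + xi x y 4 = -4 * (Dij x y 0 4 * Dij x y 1 2 * Dij x y 3 5) := by
  simp [xi, Dij]; ring

theorem xi_add_15 {k : Type*} [CommRing k] (x y : Fin 6 → k) :
    xi x y 1 + xi x y 5 = -4 * (Dij x y 0 5 * Dij x y 1 3 * Dij x y 2 4) := by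
  simp [xi, Dij]; ring

theorem xi_add_23 {k : Type*} [CommRing k] (x y : Fin 6 → k) :
    xi x y 2 + xi x y 3 = -4 * (Dij x y 0 1 * Dij x y 2 4 * Dij x y 3 5) := by
  simp [xi, Dij]; ring

theorem xi_add_24 {k : Type*} [CommRing k] (x y : Fin 6 → k) :
    xi x y 2 + xi x y 4 = -4 * (Dij x y 0 2 * Dij x y 1 3 * Dij x y 4 5) := by
  simp [xi, Dij]; ring

theorem xi_add_25 {k : Type*} [CommRing k] (x y : Fin 6 → k) :
    xi x y 2 + xi x y 5 = -4 * (Dij x y 0 4 * Dij x y 1 5 * Dij x y 2 3) := by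
  simp [xi, Dij]; ring

theorem xi_add_34 {k : Type*} [CommRing k] (x y : Fin 6 → k) :
    xi x y 3 + xi x y 4 = 4 * (Dij x y 0 5 * Dij x y 1 4 * Dij x y 2 3) := by
  simp [xi, Dij]; ring

theorem xi_add_35 {k : Type*} [CommRing k] (x y : Fin 6 → k) :
    xi x y 3 + xi x y 5 = 4 * (Dij x y 0 3 * Dij x y 1 2 * Dij x y 4 5) := by
  simp [xi, Dij]; ring

theorem xi_add_45 {k : Type*} [CommRing k] (x y : Fin 6 → k) :
    xi x y 4 + xi x y 5 = 4 * (Dij x y 0 1 * Dij x y 2 5 * Dij x y 3 4) := by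
  simp [xi, Dij]; ring

theorem xi_tri_0 {k : Type*} [CommRing k] (x y : Fin 6 → k) :
    16 * (Dij x y 0 1 * Dij x y 1 2 * Dij x y 0 2 *
      (Dij x y 3 4 * Dij x y 4 5 * Dij x y 3 5)) =
    (xi x y 0 * xi x y 3 + xi x y 3 * xi x y 4 + xi x y 0 * xi x y 4) -
    (xi x y 1 * xi x y 2 + xi x y 2 * xi x y 5 + xi x y 1 * xi x y 5) := by
  simp [xi, Dij]; ring

theorem xi_tri_1 {k : Type*} [CommRing k] (x y : Fin 6 → k) :
    16 * (Dij x y 0 1 * Dij x y 1 3 * Dij x y 0 3 *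
      (Dij x y 2 4 * Dij x y 4 5 * Dij x y 2 5)) =
    (xi x y 1 * xi x y 3 + xi x y 3 * xi x y 4 + xi x y 1 * xi x y 4) -
    (xi x y 0 * xi x y 2 + xi x y 2 * xi x y 5 + xi x y 0 * xi x y 5) := by
  simp [xi, Dij]; ring

theorem xi_tri_2 {k : Type*} [CommRing k] (x y : Fin 6 → k) :
    16 * (Dij x y 0 1 * Dij x y 1 4 * Dij x y 0 4 *
      (Dij x y 2 3 * Dij x y 3 5 * Dij x y 2 5)) =
    (xi x y 1 * xi x y 3 + xi x y 3 * xi x y 5 + xi x y 1 * xi x y 5) -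
    (xi x y 0 * xi x y 2 + xi x y 2 * xi x y 4 + xi x y 0 * xi x y 4) := by
  simp [xi, Dij]; ring

theorem xi_tri_3 {k : Type*} [CommRing k] (x y : Fin 6 → k) :
    16 * (Dij x y 0 1 * Dij x y 1 5 * Dij x y 0 5 *
      (Dij x y 2 3 * Dij x y 3 4 * Dij x y 2 4)) =
    (xi x y 0 * xi x y 3 + xi x y 3 * xi x y 5 + xi x y 0 * xi x y 5) -
    (xi x y 1 * xi x y 2 + xi x y 2 * xi x y 4 + xi x y 1 * xi x y 4) := by
  simp [xi, Dij]; ring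

theorem xi_tri_4 {k : Type*} [CommRing k] (x y : Fin 6 → k) :
    16 * (Dij x y 0 2 * Dij x y 2 3 * Dij x y 0 3 *
      (Dij x y 1 4 * Dij x y 4 5 * Dij x y 1 5)) =
    (xi x y 1 * xi x y 4 + xi x y 4 * xi x y 5 + xi x y 1 * xi x y 5) -
    (xi x y 0 * xi x y 2 + xi x y 2 * xi x y 3 + xi x y 0 * xi x y 3) := by
  simp [xi, Dij]; ring

theorem xi_tri_5 {k : Type*} [CommRing k] (x y : Fin 6 → k) :
    16 * (Dij x y 0 2 * Dij x y 2 4 * Dij x y 0 4 *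
      (Dij x y 1 3 * Dij x y 3 5 * Dij x y 1 5)) =
    (xi x y 3 * xi x y 4 + xi x y 4 * xi x y 5 + xi x y 3 * xi x y 5) -
    (xi x y 0 * xi x y 1 + xi x y 1 * xi x y 2 + xi x y 0 * xi x y 2) := by
  simp [xi, Dij]; ring

theorem xi_tri_6 {k : Type*} [CommRing k] (x y : Fin 6 → k) :
    16 * (Dij x y 0 2 * Dij x y 2 5 * Dij x y 0 5 *
      (Dij x y 1 3 * Dij x y 3 4 * Dij x y 1 4)) =
    (xi x y 2 * xi x y 3 + xi x y 3 * xi x y 5 + xi x y 2 * xi x y 5) -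
    (xi x y 0 * xi x y 1 + xi x y 1 * xi x y 4 + xi x y 0 * xi x y 4) := by
  simp [xi, Dij]; ring

theorem xi_tri_7 {k : Type*} [CommRing k] (x y : Fin 6 → k) :
    16 * (Dij x y 0 3 * Dij x y 3 4 * Dij x y 0 4 *
      (Dij x y 1 2 * Dij x y 2 5 * Dij x y 1 5)) =
    (xi x y 2 * xi x y 3 + xi x y 3 * xi x y 4 + xi x y 2 * xi x y 4) -
    (xi x y 0 * xi x y 1 + xi x y 1 * xi x y 5 + xi x y 0 * xi x y 5) := by
  simp [xi, Dij]; ring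

theorem xi_tri_8 {k : Type*} [CommRing k] (x y : Fin 6 → k) :
    16 * (Dij x y 0 3 * Dij x y 3 5 * Dij x y 0 5 *
      (Dij x y 1 2 * Dij x y 2 4 * Dij x y 1 4)) =
    (xi x y 2 * xi x y 4 + xi x y 4 * xi x y 5 + xi x y 2 * xi x y 5) -
    (xi x y 0 * xi x y 1 + xi x y 1 * xi x y 3 + xi x y 0 * xi x y 3) := by
  simp [xi, Dij]; ring

theorem xi_tri_9 {k : Type*} [CommRing k] (x y : Fin 6 → k) :
    16 * (Dij x y 0 4 * Dij x y 4 5 * Dij x y 0 5 *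
      (Dij x y 1 2 * Dij x y 2 3 * Dij x y 1 3)) =
    (xi x y 0 * xi x y 4 + xi x y 4 * xi x y 5 + xi x y 0 * xi x y 5) -
    (xi x y 1 * xi x y 2 + xi x y 2 * xi x y 3 + xi x y 1 * xi x y 3) := by
  simp [xi, Dij]; ring


/-- Elementary symmetric function of degree 1 of six elements. -/
def es1 {k : Type*} [CommRing k] (z : Fin 6 → k) : k :=
    z 0 + z 1 + z 2 + z 3 + z 4 + z 5

set_option maxRecDepth 10000 in
theorem eval_esymm1 {k : Type*} [CommRing k] (z : Fin 6 → k) :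
    eval z (esymm (Fin 6) k 1) = es1 z := by
  have h : (Finset.powersetCard 1 (Finset.univ : Finset (Fin 6))) =
    {{0}, {1}, {2}, {3}, {4}, {5}} := by
    decide +kernel
  rw [esymm, h]
  simp only [map_sum, map_prod, eval_X]
  repeat rw [Finset.sum_insert (by decide +kernel)]
  rw [Finset.sum_singleton]
  simp [es1]
  try ring

/-- Elementary symmetric function of degree 2 of six elements. -/
def es2 {k : Type*} [CommRing k] (z : Fin 6 → k) : k :=
    z 0 * z 1 + z 0 * z 2 + z 0 * z 3 + z 0 * z 4 + z 0 * z 5 + z 1 * z 2 + z 1 * z 3 + z 1 *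
    z 4 + z 1 * z 5 + z 2 * z 3 + z 2 * z 4 + z 2 * z 5 + z 3 * z 4 + z 3 * z 5 + z 4 * z 5

set_option maxRecDepth 10000 in
theorem eval_esymm2 {k : Type*} [CommRing k] (z : Fin 6 → k) :
    eval z (esymm (Fin 6) k 2) = es2 z := by
  have h : (Finset.powersetCard 2 (Finset.univ : Finset (Fin 6))) =
    {{0,1}, {0,2}, {0,3}, {0,4}, {0,5}, {1,2}, {1,3}, {1,4}, {1,5}, {2,3}, {2,4}, {2,5},
    {3,4}, {3,5}, {4,5}} := by
    decide +kernel
  rw [esymm, h]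
  simp only [map_sum, map_prod, eval_X]
  repeat rw [Finset.sum_insert (by decide +kernel)]
  rw [Finset.sum_singleton]
  simp [es2]
  try ring

/-- Elementary symmetric function of degree 3 of six elements. -/
def es3 {k : Type*} [CommRing k] (z : Fin 6 → k) : k :=
    z 0 * z 1 * z 2 + z 0 * z 1 * z 3 + z 0 * z 1 * z 4 + z 0 * z 1 * z 5 + z 0 * z 2 * z 3 +
    z 0 * z 2 * z 4 + z 0 * z 2 * z 5 + z 0 * z 3 * z 4 + z 0 * z 3 * z 5 + z 0 * z 4 * z 5 +
    z 1 * z 2 * z 3 + z 1 * z 2 * z 4 + z 1 * z 2 * z 5 + z 1 * z 3 * z 4 + z 1 * z 3 * z 5 +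
    z 1 * z 4 * z 5 + z 2 * z 3 * z 4 + z 2 * z 3 * z 5 + z 2 * z 4 * z 5 + z 3 * z 4 * z 5

set_option maxRecDepth 10000 in
theorem eval_esymm3 {k : Type*} [CommRing k] (z : Fin 6 → k) :
    eval z (esymm (Fin 6) k 3) = es3 z := by
  have h : (Finset.powersetCard 3 (Finset.univ : Finset (Fin 6))) =
    {{0,1,2}, {0,1,3}, {0,1,4}, {0,1,5}, {0,2,3}, {0,2,4}, {0,2,5}, {0,3,4}, {0,3,5}, {0,4,5},
    {1,2,3}, {1,2,4}, {1,2,5}, {1,3,4}, {1,3,5}, {1,4,5}, {2,3,4}, {2,3,5}, {2,4,5}, {3,4,5}} := by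
    decide +kernel
  rw [esymm, h]
  simp only [map_sum, map_prod, eval_X]
  repeat rw [Finset.sum_insert (by decide +kernel)]
  rw [Finset.sum_singleton]
  simp [es3]
  try ring

/-- Elementary symmetric function of degree 4 of six elements. -/
def es4 {k : Type*} [CommRing k] (z : Fin 6 → k) : k :=
    z 0 * z 1 * z 2 * z 3 + z 0 * z 1 * z 2 * z 4 + z 0 * z 1 * z 2 * z 5 + z 0 * z 1 * z 3 *
    z 4 + z 0 * z 1 * z 3 * z 5 + z 0 * z 1 * z 4 * z 5 + z 0 * z 2 * z 3 * z 4 + z 0 * z 2 *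
    z 3 * z 5 + z 0 * z 2 * z 4 * z 5 + z 0 * z 3 * z 4 * z 5 + z 1 * z 2 * z 3 * z 4 + z 1 *
    z 2 * z 3 * z 5 + z 1 * z 2 * z 4 * z 5 + z 1 * z 3 * z 4 * z 5 + z 2 * z 3 * z 4 * z 5

set_option maxRecDepth 10000 in
theorem eval_esymm4 {k : Type*} [CommRing k] (z : Fin 6 → k) :
    eval z (esymm (Fin 6) k 4) = es4 z := by
  have h : (Finset.powersetCard 4 (Finset.univ : Finset (Fin 6))) =
    {{0,1,2,3}, {0,1,2,4}, {0,1,2,5}, {0,1,3,4}, {0,1,3,5}, {0,1,4,5}, {0,2,3,4}, {0,2,3,5},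
    {0,2,4,5}, {0,3,4,5}, {1,2,3,4}, {1,2,3,5}, {1,2,4,5}, {1,3,4,5}, {2,3,4,5}} := by
    decide +kernel
  rw [esymm, h]
  simp only [map_sum, map_prod, eval_X]
  repeat rw [Finset.sum_insert (by decide +kernel)]
  rw [Finset.sum_singleton]
  simp [es4]
  try ring

/-- Elementary symmetric function of degree 5 of six elements. -/
def es5 {k : Type*} [CommRing k] (z : Fin 6 → k) : k :=
    z 0 * z 1 * z 2 * z 3 * z 4 + z 0 * z 1 * z 2 * z 3 * z 5 + z 0 * z 1 * z 2 * z 4 * z 5 +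
    z 0 * z 1 * z 3 * z 4 * z 5 + z 0 * z 2 * z 3 * z 4 * z 5 + z 1 * z 2 * z 3 * z 4 * z 5

set_option maxRecDepth 10000 in
theorem eval_esymm5 {k : Type*} [CommRing k] (z : Fin 6 → k) :
    eval z (esymm (Fin 6) k 5) = es5 z := by
  have h : (Finset.powersetCard 5 (Finset.univ : Finset (Fin 6))) =
    {{0,1,2,3,4}, {0,1,2,3,5}, {0,1,2,4,5}, {0,1,3,4,5}, {0,2,3,4,5}, {1,2,3,4,5}} := by
    decide +kernel
  rw [esymm, h]
  simp only [map_sum, map_prod, eval_X]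
  repeat rw [Finset.sum_insert (by decide +kernel)]
  rw [Finset.sum_singleton]
  simp [es5]
  try ring

/-- Elementary symmetric function of degree 6 of six elements. -/
def es6 {k : Type*} [CommRing k] (z : Fin 6 → k) : k :=
    z 0 * z 1 * z 2 * z 3 * z 4 * z 5

set_option maxRecDepth 10000 in
theorem eval_esymm6 {k : Type*} [CommRing k] (z : Fin 6 → k) :
    eval z (esymm (Fin 6) k 6) = es6 z := by
  have h : (Finset.powersetCard 6 (Finset.univ : Finset (Fin 6))) =
    {{0,1,2,3,4,5}} := by
    decide +kernel
  rw [esymm, h]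
  simp only [map_sum, map_prod, eval_X]
  repeat rw [Finset.sum_insert (by decide +kernel)]
  rw [Finset.sum_singleton]
  simp [es6]
  try ring

theorem xi_es1 {k : Type*} [CommRing k] (x y : Fin 6 → k) : es1 (xi x y) = 0 := by
  simp [es1, xi, Dij]; ring

theorem xi_five {k : Type*} [CommRing k] (x y : Fin 6 → k) :
    xi x y 5 = -(xi x y 0 + xi x y 1 + xi x y 2 + xi x y 3 + xi x y 4) := by
  have := xi_es1 x y
  rw [es1] at this
  linear_combination this

theorem xi_es3 {k : Type*} [CommRing k] (x y : Fin 6 → k) : es3 (xi x y) = 0 := by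
  have h : (xi x y 0 + xi x y 1) * (xi x y 1 + xi x y 2) * (xi x y 0 + xi x y 2) +
      (xi x y 3 + xi x y 4) * (xi x y 4 + xi x y 5) * (xi x y 3 + xi x y 5) = 0 := by
    rw [xi_add_01, xi_add_12, xi_add_02, xi_add_34, xi_add_45, xi_add_35]
    ring
  rw [es3]
  rw [xi_five] at h ⊢
  linear_combination -h

/-- The square root of the discriminant. -/
def sqrtDisc {k : Type*} [CommRing k] (x y : Fin 6 → k) : k :=
    Dij x y 0 1 * Dij x y 0 2 * Dij x y 0 3 * Dij x y 0 4 * Dij x y 0 5 * Dij x y 1 2 * Dij x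
    y 1 3 * Dij x y 1 4 * Dij x y 1 5 * Dij x y 2 3 * Dij x y 2 4 * Dij x y 2 5 * Dij x y 3 4
    * Dij x y 3 5 * Dij x y 4 5

theorem xi_es5 {k : Type*} [CommRing k] (x y : Fin 6 → k) :
    es5 (xi x y) = 1024 * sqrtDisc x y := by
  have h : (xi x y 0 + xi x y 1) * (xi x y 0 + xi x y 2) * (xi x y 0 + xi x y 3) *
      (xi x y 0 + xi x y 4) * (xi x y 0 + xi x y 5) = 1024 * sqrtDisc x y := by
    rw [xi_add_01, xi_add_02, xi_add_03, xi_add_04, xi_add_05, sqrtDisc]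
    ring
  have h3 := xi_es3 x y
  rw [← h]
  rw [es3] at h3
  rw [es5]
  rw [xi_five] at h3 ⊢
  linear_combination -(xi x y 0)^2 * h3

theorem xi_sq_01 {k : Type*} [Field k] (h2 : (2 : k) ≠ 0) (x y : Fin 6 → k) :
    Dij x y 0 1 ^ 2 * Dij x y 2 3 ^ 2 * Dij x y 4 5 ^ 2 =
      (xi x y 0 + xi x y 1) ^ 2 / 16 := by
  have h16 : (16 : k) ≠ 0 := by
    rw [show (16 : k) = 2 ^ 4 by norm_num]; exact pow_ne_zero _ h2
  rw [xi_add_01, eq_div_iff h16]; ring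

theorem xi_sq_02 {k : Type*} [Field k] (h2 : (2 : k) ≠ 0) (x y : Fin 6 → k) :
    Dij x y 0 5 ^ 2 * Dij x y 1 2 ^ 2 * Dij x y 3 4 ^ 2 =
      (xi x y 0 + xi x y 2) ^ 2 / 16 := by
  have h16 : (16 : k) ≠ 0 := by
    rw [show (16 : k) = 2 ^ 4 by norm_num]; exact pow_ne_zero _ h2
  rw [xi_add_02, eq_div_iff h16]; ring

theorem xi_sq_03 {k : Type*} [Field k] (h2 : (2 : k) ≠ 0) (x y : Fin 6 → k) :
    Dij x y 0 4 ^ 2 * Dij x y 1 3 ^ 2 * Dij x y 2 5 ^ 2 =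
      (xi x y 0 + xi x y 3) ^ 2 / 16 := by
  have h16 : (16 : k) ≠ 0 := by
    rw [show (16 : k) = 2 ^ 4 by norm_num]; exact pow_ne_zero _ h2
  rw [xi_add_03, eq_div_iff h16]; ring

theorem xi_sq_04 {k : Type*} [Field k] (h2 : (2 : k) ≠ 0) (x y : Fin 6 → k) :
    Dij x y 0 3 ^ 2 * Dij x y 1 5 ^ 2 * Dij x y 2 4 ^ 2 =
      (xi x y 0 + xi x y 4) ^ 2 / 16 := by
  have h16 : (16 : k) ≠ 0 := by
    rw [show (16 : k) = 2 ^ 4 by norm_num]; exact pow_ne_zero _ h2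
  rw [xi_add_04, eq_div_iff h16]; ring

theorem xi_sq_05 {k : Type*} [Field k] (h2 : (2 : k) ≠ 0) (x y : Fin 6 → k) :
    Dij x y 0 2 ^ 2 * Dij x y 1 4 ^ 2 * Dij x y 3 5 ^ 2 =
      (xi x y 0 + xi x y 5) ^ 2 / 16 := by
  have h16 : (16 : k) ≠ 0 := by
    rw [show (16 : k) = 2 ^ 4 by norm_num]; exact pow_ne_zero _ h2
  rw [xi_add_05, eq_div_iff h16]; ring

theorem xi_sq_12 {k : Type*} [Field k] (h2 : (2 : k) ≠ 0) (x y : Fin 6 → k) :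
    Dij x y 0 3 ^ 2 * Dij x y 1 4 ^ 2 * Dij x y 2 5 ^ 2 =
      (xi x y 1 + xi x y 2) ^ 2 / 16 := by
  have h16 : (16 : k) ≠ 0 := by
    rw [show (16 : k) = 2 ^ 4 by norm_num]; exact pow_ne_zero _ h2
  rw [xi_add_12, eq_div_iff h16]; ring

theorem xi_sq_13 {k : Type*} [Field k] (h2 : (2 : k) ≠ 0) (x y : Fin 6 → k) :
    Dij x y 0 2 ^ 2 * Dij x y 1 5 ^ 2 * Dij x y 3 4 ^ 2 =
      (xi x y 1 + xi x y 3) ^ 2 / 16 := by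
  have h16 : (16 : k) ≠ 0 := by
    rw [show (16 : k) = 2 ^ 4 by norm_num]; exact pow_ne_zero _ h2
  rw [xi_add_13, eq_div_iff h16]; ring

theorem xi_sq_14 {k : Type*} [Field k] (h2 : (2 : k) ≠ 0) (x y : Fin 6 → k) :
    Dij x y 0 4 ^ 2 * Dij x y 1 2 ^ 2 * Dij x y 3 5 ^ 2 =
      (xi x y 1 + xi x y 4) ^ 2 / 16 := by
  have h16 : (16 : k) ≠ 0 := by
    rw [show (16 : k) = 2 ^ 4 by norm_num]; exact pow_ne_zero _ h2
  rw [xi_add_14, eq_div_iff h16]; ring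

theorem xi_sq_15 {k : Type*} [Field k] (h2 : (2 : k) ≠ 0) (x y : Fin 6 → k) :
    Dij x y 0 5 ^ 2 * Dij x y 1 3 ^ 2 * Dij x y 2 4 ^ 2 =
      (xi x y 1 + xi x y 5) ^ 2 / 16 := by
  have h16 : (16 : k) ≠ 0 := by
    rw [show (16 : k) = 2 ^ 4 by norm_num]; exact pow_ne_zero _ h2
  rw [xi_add_15, eq_div_iff h16]; ring

theorem xi_sq_23 {k : Type*} [Field k] (h2 : (2 : k) ≠ 0) (x y : Fin 6 → k) :
    Dij x y 0 1 ^ 2 * Dij x y 2 4 ^ 2 * Dij x y 3 5 ^ 2 =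
      (xi x y 2 + xi x y 3) ^ 2 / 16 := by
  have h16 : (16 : k) ≠ 0 := by
    rw [show (16 : k) = 2 ^ 4 by norm_num]; exact pow_ne_zero _ h2
  rw [xi_add_23, eq_div_iff h16]; ring

theorem xi_sq_24 {k : Type*} [Field k] (h2 : (2 : k) ≠ 0) (x y : Fin 6 → k) :
    Dij x y 0 2 ^ 2 * Dij x y 1 3 ^ 2 * Dij x y 4 5 ^ 2 =
      (xi x y 2 + xi x y 4) ^ 2 / 16 := by
  have h16 : (16 : k) ≠ 0 := by
    rw [show (16 : k) = 2 ^ 4 by norm_num]; exact pow_ne_zero _ h2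
  rw [xi_add_24, eq_div_iff h16]; ring

theorem xi_sq_25 {k : Type*} [Field k] (h2 : (2 : k) ≠ 0) (x y : Fin 6 → k) :
    Dij x y 0 4 ^ 2 * Dij x y 1 5 ^ 2 * Dij x y 2 3 ^ 2 =
      (xi x y 2 + xi x y 5) ^ 2 / 16 := by
  have h16 : (16 : k) ≠ 0 := by
    rw [show (16 : k) = 2 ^ 4 by norm_num]; exact pow_ne_zero _ h2
  rw [xi_add_25, eq_div_iff h16]; ring

theorem xi_sq_34 {k : Type*} [Field k] (h2 : (2 : k) ≠ 0) (x y : Fin 6 → k) :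
    Dij x y 0 5 ^ 2 * Dij x y 1 4 ^ 2 * Dij x y 2 3 ^ 2 =
      (xi x y 3 + xi x y 4) ^ 2 / 16 := by
  have h16 : (16 : k) ≠ 0 := by
    rw [show (16 : k) = 2 ^ 4 by norm_num]; exact pow_ne_zero _ h2
  rw [xi_add_34, eq_div_iff h16]; ring

theorem xi_sq_35 {k : Type*} [Field k] (h2 : (2 : k) ≠ 0) (x y : Fin 6 → k) :
    Dij x y 0 3 ^ 2 * Dij x y 1 2 ^ 2 * Dij x y 4 5 ^ 2 =
      (xi x y 3 + xi x y 5) ^ 2 / 16 := by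
  have h16 : (16 : k) ≠ 0 := by
    rw [show (16 : k) = 2 ^ 4 by norm_num]; exact pow_ne_zero _ h2
  rw [xi_add_35, eq_div_iff h16]; ring

theorem xi_sq_45 {k : Type*} [Field k] (h2 : (2 : k) ≠ 0) (x y : Fin 6 → k) :
    Dij x y 0 1 ^ 2 * Dij x y 2 5 ^ 2 * Dij x y 3 4 ^ 2 =
      (xi x y 4 + xi x y 5) ^ 2 / 16 := by
  have h16 : (16 : k) ≠ 0 := by
    rw [show (16 : k) = 2 ^ 4 by norm_num]; exact pow_ne_zero _ h2
  rw [xi_add_45, eq_div_iff h16]; ring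

theorem Dij_sq_symm {k : Type*} [CommRing k] (x y : Fin 6 → k) (i j : Fin 6) :
    Dij x y i j ^ 2 = Dij x y j i ^ 2 := by
  simp only [Dij]; ring

theorem xi_es2 {k : Type*} [Field k] (h2 : (2 : k) ≠ 0) (h3 : (3 : k) ≠ 0) (x y : Fin 6 → k) :
    es2 (xi x y) = 4 * I2r x y := by
  have h48 : (48 : k) ≠ 0 := by
    rw [show (48 : k) = 2 ^ 4 * 3 by norm_num]; exact mul_ne_zero (pow_ne_zero _ h2) h3
  have h16 : (16 : k) ≠ 0 := by
    rw [show (16 : k) = 2 ^ 4 by norm_num]; exact pow_ne_zero _ h2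
  rw [I2r, sumPairs, perm_pairs (fun i j => Dij x y i j ^ 2) (Dij_sq_symm x y), es2]
  beta_reduce
  rw [xi_sq_01 h2, xi_sq_02 h2, xi_sq_03 h2, xi_sq_04 h2, xi_sq_05 h2, xi_sq_12 h2, xi_sq_13 h2, xi_sq_14 h2, xi_sq_15 h2, xi_sq_23 h2, xi_sq_24 h2, xi_sq_25 h2, xi_sq_34 h2, xi_sq_35 h2, xi_sq_45 h2]
  rw [xi_five]
  field_simp
  ring


theorem sumB_eq {k : Type*} [Field k] (h2 : (2 : k) ≠ 0) (h3 : (3 : k) ≠ 0) (x y : Fin 6 → k) :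
    64 * sumB x y = es2 (xi x y) ^ 2 - 3 * es4 (xi x y) := by
  have h72 : (72 : k) ≠ 0 := by
    rw [show (72 : k) = 2 ^ 3 * 3 ^ 2 by norm_num]
    exact mul_ne_zero (pow_ne_zero _ h2) (pow_ne_zero _ h3)
  have h256 : (256 : k) ≠ 0 := by
    rw [show (256 : k) = 2 ^ 8 by norm_num]; exact pow_ne_zero _ h2
  have b0 : Dij x y 0 1 ^ 2 * Dij x y 1 2 ^ 2 * Dij x y 0 2 ^ 2 *
      (Dij x y 3 4 ^ 2 * Dij x y 4 5 ^ 2 * Dij x y 3 5 ^ 2) =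
      ((xi x y 0 * xi x y 3 + xi x y 3 * xi x y 4 + xi x y 0 * xi x y 4) -
      (xi x y 1 * xi x y 2 + xi x y 2 * xi x y 5 + xi x y 1 * xi x y 5)) ^ 2 / 256 := by
    rw [eq_div_iff h256]
    linear_combination (16 * (Dij x y 0 1 * Dij x y 1 2 * Dij x y 0 2 *
      (Dij x y 3 4 * Dij x y 4 5 * Dij x y 3 5)) +
      ((xi x y 0 * xi x y 3 + xi x y 3 * xi x y 4 + xi x y 0 * xi x y 4) - (xi x y 1 * xi x y 2 + xi x y 2 * xi x y 5 + xi x y 1 * xi x y 5))) * xi_tri_0 x y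
  have b1 : Dij x y 0 1 ^ 2 * Dij x y 1 3 ^ 2 * Dij x y 0 3 ^ 2 *
      (Dij x y 2 4 ^ 2 * Dij x y 4 5 ^ 2 * Dij x y 2 5 ^ 2) =
      ((xi x y 0 * xi x y 2 + xi x y 2 * xi x y 5 + xi x y 0 * xi x y 5) -
      (xi x y 1 * xi x y 3 + xi x y 3 * xi x y 4 + xi x y 1 * xi x y 4)) ^ 2 / 256 := by
    rw [eq_div_iff h256]
    linear_combination (16 * (Dij x y 0 1 * Dij x y 1 3 * Dij x y 0 3 *
      (Dij x y 2 4 * Dij x y 4 5 * Dij x y 2 5)) -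
      ((xi x y 0 * xi x y 2 + xi x y 2 * xi x y 5 + xi x y 0 * xi x y 5) - (xi x y 1 * xi x y 3 + xi x y 3 * xi x y 4 + xi x y 1 * xi x y 4))) * xi_tri_1 x y
  have b2 : Dij x y 0 1 ^ 2 * Dij x y 1 4 ^ 2 * Dij x y 0 4 ^ 2 *
      (Dij x y 2 3 ^ 2 * Dij x y 3 5 ^ 2 * Dij x y 2 5 ^ 2) =
      ((xi x y 0 * xi x y 2 + xi x y 2 * xi x y 4 + xi x y 0 * xi x y 4) -
      (xi x y 1 * xi x y 3 + xi x y 3 * xi x y 5 + xi x y 1 * xi x y 5)) ^ 2 / 256 := by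
    rw [eq_div_iff h256]
    linear_combination (16 * (Dij x y 0 1 * Dij x y 1 4 * Dij x y 0 4 *
      (Dij x y 2 3 * Dij x y 3 5 * Dij x y 2 5)) -
      ((xi x y 0 * xi x y 2 + xi x y 2 * xi x y 4 + xi x y 0 * xi x y 4) - (xi x y 1 * xi x y 3 + xi x y 3 * xi x y 5 + xi x y 1 * xi x y 5))) * xi_tri_2 x y
  have b3 : Dij x y 0 1 ^ 2 * Dij x y 1 5 ^ 2 * Dij x y 0 5 ^ 2 *
      (Dij x y 2 3 ^ 2 * Dij x y 3 4 ^ 2 * Dij x y 2 4 ^ 2) =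
      ((xi x y 0 * xi x y 3 + xi x y 3 * xi x y 5 + xi x y 0 * xi x y 5) -
      (xi x y 1 * xi x y 2 + xi x y 2 * xi x y 4 + xi x y 1 * xi x y 4)) ^ 2 / 256 := by
    rw [eq_div_iff h256]
    linear_combination (16 * (Dij x y 0 1 * Dij x y 1 5 * Dij x y 0 5 *
      (Dij x y 2 3 * Dij x y 3 4 * Dij x y 2 4)) +
      ((xi x y 0 * xi x y 3 + xi x y 3 * xi x y 5 + xi x y 0 * xi x y 5) - (xi x y 1 * xi x y 2 + xi x y 2 * xi x y 4 + xi x y 1 * xi x y 4))) * xi_tri_3 x y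
  have b4 : Dij x y 0 2 ^ 2 * Dij x y 2 3 ^ 2 * Dij x y 0 3 ^ 2 *
      (Dij x y 1 4 ^ 2 * Dij x y 4 5 ^ 2 * Dij x y 1 5 ^ 2) =
      ((xi x y 0 * xi x y 2 + xi x y 2 * xi x y 3 + xi x y 0 * xi x y 3) -
      (xi x y 1 * xi x y 4 + xi x y 4 * xi x y 5 + xi x y 1 * xi x y 5)) ^ 2 / 256 := by
    rw [eq_div_iff h256]
    linear_combination (16 * (Dij x y 0 2 * Dij x y 2 3 * Dij x y 0 3 *
      (Dij x y 1 4 * Dij x y 4 5 * Dij x y 1 5)) -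
      ((xi x y 0 * xi x y 2 + xi x y 2 * xi x y 3 + xi x y 0 * xi x y 3) - (xi x y 1 * xi x y 4 + xi x y 4 * xi x y 5 + xi x y 1 * xi x y 5))) * xi_tri_4 x y
  have b5 : Dij x y 0 2 ^ 2 * Dij x y 2 4 ^ 2 * Dij x y 0 4 ^ 2 *
      (Dij x y 1 3 ^ 2 * Dij x y 3 5 ^ 2 * Dij x y 1 5 ^ 2) =
      ((xi x y 0 * xi x y 1 + xi x y 1 * xi x y 2 + xi x y 0 * xi x y 2) -
      (xi x y 3 * xi x y 4 + xi x y 4 * xi x y 5 + xi x y 3 * xi x y 5)) ^ 2 / 256 := by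
    rw [eq_div_iff h256]
    linear_combination (16 * (Dij x y 0 2 * Dij x y 2 4 * Dij x y 0 4 *
      (Dij x y 1 3 * Dij x y 3 5 * Dij x y 1 5)) -
      ((xi x y 0 * xi x y 1 + xi x y 1 * xi x y 2 + xi x y 0 * xi x y 2) - (xi x y 3 * xi x y 4 + xi x y 4 * xi x y 5 + xi x y 3 * xi x y 5))) * xi_tri_5 x y
  have b6 : Dij x y 0 2 ^ 2 * Dij x y 2 5 ^ 2 * Dij x y 0 5 ^ 2 *
      (Dij x y 1 3 ^ 2 * Dij x y 3 4 ^ 2 * Dij x y 1 4 ^ 2) =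
      ((xi x y 0 * xi x y 1 + xi x y 1 * xi x y 4 + xi x y 0 * xi x y 4) -
      (xi x y 2 * xi x y 3 + xi x y 3 * xi x y 5 + xi x y 2 * xi x y 5)) ^ 2 / 256 := by
    rw [eq_div_iff h256]
    linear_combination (16 * (Dij x y 0 2 * Dij x y 2 5 * Dij x y 0 5 *
      (Dij x y 1 3 * Dij x y 3 4 * Dij x y 1 4)) -
      ((xi x y 0 * xi x y 1 + xi x y 1 * xi x y 4 + xi x y 0 * xi x y 4) - (xi x y 2 * xi x y 3 + xi x y 3 * xi x y 5 + xi x y 2 * xi x y 5))) * xi_tri_6 x y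
  have b7 : Dij x y 0 3 ^ 2 * Dij x y 3 4 ^ 2 * Dij x y 0 4 ^ 2 *
      (Dij x y 1 2 ^ 2 * Dij x y 2 5 ^ 2 * Dij x y 1 5 ^ 2) =
      ((xi x y 0 * xi x y 1 + xi x y 1 * xi x y 5 + xi x y 0 * xi x y 5) -
      (xi x y 2 * xi x y 3 + xi x y 3 * xi x y 4 + xi x y 2 * xi x y 4)) ^ 2 / 256 := by
    rw [eq_div_iff h256]
    linear_combination (16 * (Dij x y 0 3 * Dij x y 3 4 * Dij x y 0 4 *
      (Dij x y 1 2 * Dij x y 2 5 * Dij x y 1 5)) -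
      ((xi x y 0 * xi x y 1 + xi x y 1 * xi x y 5 + xi x y 0 * xi x y 5) - (xi x y 2 * xi x y 3 + xi x y 3 * xi x y 4 + xi x y 2 * xi x y 4))) * xi_tri_7 x y
  have b8 : Dij x y 0 3 ^ 2 * Dij x y 3 5 ^ 2 * Dij x y 0 5 ^ 2 *
      (Dij x y 1 2 ^ 2 * Dij x y 2 4 ^ 2 * Dij x y 1 4 ^ 2) =
      ((xi x y 0 * xi x y 1 + xi x y 1 * xi x y 3 + xi x y 0 * xi x y 3) -
      (xi x y 2 * xi x y 4 + xi x y 4 * xi x y 5 + xi x y 2 * xi x y 5)) ^ 2 / 256 := by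
    rw [eq_div_iff h256]
    linear_combination (16 * (Dij x y 0 3 * Dij x y 3 5 * Dij x y 0 5 *
      (Dij x y 1 2 * Dij x y 2 4 * Dij x y 1 4)) -
      ((xi x y 0 * xi x y 1 + xi x y 1 * xi x y 3 + xi x y 0 * xi x y 3) - (xi x y 2 * xi x y 4 + xi x y 4 * xi x y 5 + xi x y 2 * xi x y 5))) * xi_tri_8 x y
  have b9 : Dij x y 0 4 ^ 2 * Dij x y 4 5 ^ 2 * Dij x y 0 5 ^ 2 *
      (Dij x y 1 2 ^ 2 * Dij x y 2 3 ^ 2 * Dij x y 1 3 ^ 2) =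
      ((xi x y 0 * xi x y 4 + xi x y 4 * xi x y 5 + xi x y 0 * xi x y 5) -
      (xi x y 1 * xi x y 2 + xi x y 2 * xi x y 3 + xi x y 1 * xi x y 3)) ^ 2 / 256 := by
    rw [eq_div_iff h256]
    linear_combination (16 * (Dij x y 0 4 * Dij x y 4 5 * Dij x y 0 5 *
      (Dij x y 1 2 * Dij x y 2 3 * Dij x y 1 3)) +
      ((xi x y 0 * xi x y 4 + xi x y 4 * xi x y 5 + xi x y 0 * xi x y 5) - (xi x y 1 * xi x y 2 + xi x y 2 * xi x y 3 + xi x y 1 * xi x y 3))) * xi_tri_9 x y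
  rw [sumB, perm_B (fun i j => Dij x y i j ^ 2) (Dij_sq_symm x y), es2, es4]
  beta_reduce
  rw [b0, b1, b2, b3, b4, b5, b6, b7, b8, b9]
  rw [xi_five]
  field_simp
  ring

set_option maxRecDepth 100000 in
set_option maxHeartbeats 4000000 in
theorem sumC_eq {k : Type*} [Field k] (h2 : (2 : k) ≠ 0) (h3 : (3 : k) ≠ 0) (x y : Fin 6 → k) :
    1024 * sumC x y = -2 * es2 (xi x y) ^ 3 + 5 * es2 (xi x y) * es4 (xi x y) +
      9 * es6 (xi x y) := by
  have h12 : (12 : k) ≠ 0 := by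
    rw [show (12 : k) = 2 ^ 2 * 3 by norm_num]
    exact mul_ne_zero (pow_ne_zero _ h2) h3
  have h4 : (4 : k) ≠ 0 := by
    rw [show (4 : k) = 2 ^ 2 by norm_num]; exact pow_ne_zero _ h2
  have h16 : (16 : k) ≠ 0 := by
    rw [show (16 : k) = 2 ^ 4 by norm_num]; exact pow_ne_zero _ h2
  have hs := xi_es3 x y
  rw [sumC, perm_C (fun i j => Dij x y i j ^ 2) (Dij_sq_symm x y), es2, es4, es6]
  beta_reduce
  rw [xi_sq_01 h2, xi_sq_02 h2, xi_sq_03 h2, xi_sq_04 h2, xi_sq_05 h2, xi_sq_12 h2, xi_sq_13 h2, xi_sq_14 h2, xi_sq_15 h2, xi_sq_23 h2, xi_sq_24 h2, xi_sq_25 h2, xi_sq_34 h2, xi_sq_35 h2, xi_sq_45 h2]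
  rw [inv_mul_cancel_left₀ h12]
  rw [es3] at hs
  rw [xi_five] at hs ⊢
  generalize xi x y 0 = a at *
  generalize xi x y 1 = b at *
  generalize xi x y 2 = c at *
  generalize xi x y 3 = d at *
  generalize xi x y 4 = e at *
  rw [← mul_right_inj' h4]
  simp only [div_eq_mul_inv]
  have hq : (4096 : k) * ((16 : k)⁻¹) ^ 3 = 1 := by
    rw [show (4096 : k) = 16 ^ 3 by norm_num, ← mul_pow, mul_inv_cancel₀ h16, one_pow]
  generalize (16 : k)⁻¹ = q at *
  linear_combination (exp := 1) 6 * (a * b * c + a * b * d + a * b * e + a * b * (-(a + b + c + d + e)) + a * c * d + a * c * e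
    + a * c * (-(a + b + c + d + e)) + a * d * e + a * d * (-(a + b + c + d + e)) + a * e *
    (-(a + b + c + d + e)) + b * c * d + b * c * e + b * c * (-(a + b + c + d + e)) + b * d *
    e + b * d * (-(a + b + c + d + e)) + b * e * (-(a + b + c + d + e)) + c * d * e + c * d *
    (-(a + b + c + d + e)) + c * e * (-(a + b + c + d + e)) + d * e * (-(a + b + c + d + e))) * hs +
    ((a + b) ^ 2 * (a + c) ^ 2 * (a + d) ^ 2 + (a + b) ^ 2 * (a + c) ^ 2 * (a + e) ^ 2 + (a +
    b) ^ 2 * (a + c) ^ 2 * (a + (-(a + b + c + d + e))) ^ 2 + (a + b) ^ 2 * (a + d) ^ 2 * (a +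
    e) ^ 2 + (a + b) ^ 2 * (a + d) ^ 2 * (a + (-(a + b + c + d + e))) ^ 2 + (a + b) ^ 2 * (a +
    e) ^ 2 * (a + (-(a + b + c + d + e))) ^ 2 + (a + c) ^ 2 * (a + d) ^ 2 * (a + e) ^ 2 + (a +
    c) ^ 2 * (a + d) ^ 2 * (a + (-(a + b + c + d + e))) ^ 2 + (a + c) ^ 2 * (a + e) ^ 2 * (a +
    (-(a + b + c + d + e))) ^ 2 + (a + d) ^ 2 * (a + e) ^ 2 * (a + (-(a + b + c + d + e))) ^ 2
    + (b + a) ^ 2 * (b + c) ^ 2 * (b + d) ^ 2 + (b + a) ^ 2 * (b + c) ^ 2 * (b + e) ^ 2 + (b +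
    a) ^ 2 * (b + c) ^ 2 * (b + (-(a + b + c + d + e))) ^ 2 + (b + a) ^ 2 * (b + d) ^ 2 * (b +
    e) ^ 2 + (b + a) ^ 2 * (b + d) ^ 2 * (b + (-(a + b + c + d + e))) ^ 2 + (b + a) ^ 2 * (b +
    e) ^ 2 * (b + (-(a + b + c + d + e))) ^ 2 + (b + c) ^ 2 * (b + d) ^ 2 * (b + e) ^ 2 + (b +
    c) ^ 2 * (b + d) ^ 2 * (b + (-(a + b + c + d + e))) ^ 2 + (b + c) ^ 2 * (b + e) ^ 2 * (b +
    (-(a + b + c + d + e))) ^ 2 + (b + d) ^ 2 * (b + e) ^ 2 * (b + (-(a + b + c + d + e))) ^ 2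
    + (c + a) ^ 2 * (c + b) ^ 2 * (c + d) ^ 2 + (c + a) ^ 2 * (c + b) ^ 2 * (c + e) ^ 2 + (c +
    a) ^ 2 * (c + b) ^ 2 * (c + (-(a + b + c + d + e))) ^ 2 + (c + a) ^ 2 * (c + d) ^ 2 * (c +
    e) ^ 2 + (c + a) ^ 2 * (c + d) ^ 2 * (c + (-(a + b + c + d + e))) ^ 2 + (c + a) ^ 2 * (c +
    e) ^ 2 * (c + (-(a + b + c + d + e))) ^ 2 + (c + b) ^ 2 * (c + d) ^ 2 * (c + e) ^ 2 + (c +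
    b) ^ 2 * (c + d) ^ 2 * (c + (-(a + b + c + d + e))) ^ 2 + (c + b) ^ 2 * (c + e) ^ 2 * (c +
    (-(a + b + c + d + e))) ^ 2 + (c + d) ^ 2 * (c + e) ^ 2 * (c + (-(a + b + c + d + e))) ^ 2
    + (d + a) ^ 2 * (d + b) ^ 2 * (d + c) ^ 2 + (d + a) ^ 2 * (d + b) ^ 2 * (d + e) ^ 2 + (d +
    a) ^ 2 * (d + b) ^ 2 * (d + (-(a + b + c + d + e))) ^ 2 + (d + a) ^ 2 * (d + c) ^ 2 * (d +
    e) ^ 2 + (d + a) ^ 2 * (d + c) ^ 2 * (d + (-(a + b + c + d + e))) ^ 2 + (d + a) ^ 2 * (d +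
    e) ^ 2 * (d + (-(a + b + c + d + e))) ^ 2 + (d + b) ^ 2 * (d + c) ^ 2 * (d + e) ^ 2 + (d +
    b) ^ 2 * (d + c) ^ 2 * (d + (-(a + b + c + d + e))) ^ 2 + (d + b) ^ 2 * (d + e) ^ 2 * (d +
    (-(a + b + c + d + e))) ^ 2 + (d + c) ^ 2 * (d + e) ^ 2 * (d + (-(a + b + c + d + e))) ^ 2
    + (e + a) ^ 2 * (e + b) ^ 2 * (e + c) ^ 2 + (e + a) ^ 2 * (e + b) ^ 2 * (e + d) ^ 2 + (e +
    a) ^ 2 * (e + b) ^ 2 * (e + (-(a + b + c + d + e))) ^ 2 + (e + a) ^ 2 * (e + c) ^ 2 * (e +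
    d) ^ 2 + (e + a) ^ 2 * (e + c) ^ 2 * (e + (-(a + b + c + d + e))) ^ 2 + (e + a) ^ 2 * (e +
    d) ^ 2 * (e + (-(a + b + c + d + e))) ^ 2 + (e + b) ^ 2 * (e + c) ^ 2 * (e + d) ^ 2 + (e +
    b) ^ 2 * (e + c) ^ 2 * (e + (-(a + b + c + d + e))) ^ 2 + (e + b) ^ 2 * (e + d) ^ 2 * (e +
    (-(a + b + c + d + e))) ^ 2 + (e + c) ^ 2 * (e + d) ^ 2 * (e + (-(a + b + c + d + e))) ^ 2
    + ((-(a + b + c + d + e)) + a) ^ 2 * ((-(a + b + c + d + e)) + b) ^ 2 * ((-(a + b + c + d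
    + e)) + c) ^ 2 + ((-(a + b + c + d + e)) + a) ^ 2 * ((-(a + b + c + d + e)) + b) ^ 2 *
    ((-(a + b + c + d + e)) + d) ^ 2 + ((-(a + b + c + d + e)) + a) ^ 2 * ((-(a + b + c + d +
    e)) + b) ^ 2 * ((-(a + b + c + d + e)) + e) ^ 2 + ((-(a + b + c + d + e)) + a) ^ 2 * ((-(a
    + b + c + d + e)) + c) ^ 2 * ((-(a + b + c + d + e)) + d) ^ 2 + ((-(a + b + c + d + e)) +
    a) ^ 2 * ((-(a + b + c + d + e)) + c) ^ 2 * ((-(a + b + c + d + e)) + e) ^ 2 + ((-(a + b +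
    c + d + e)) + a) ^ 2 * ((-(a + b + c + d + e)) + d) ^ 2 * ((-(a + b + c + d + e)) + e) ^ 2
    + ((-(a + b + c + d + e)) + b) ^ 2 * ((-(a + b + c + d + e)) + c) ^ 2 * ((-(a + b + c + d
    + e)) + d) ^ 2 + ((-(a + b + c + d + e)) + b) ^ 2 * ((-(a + b + c + d + e)) + c) ^ 2 *
    ((-(a + b + c + d + e)) + e) ^ 2 + ((-(a + b + c + d + e)) + b) ^ 2 * ((-(a + b + c + d +
    e)) + d) ^ 2 * ((-(a + b + c + d + e)) + e) ^ 2 + ((-(a + b + c + d + e)) + c) ^ 2 * ((-(a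
    + b + c + d + e)) + d) ^ 2 * ((-(a + b + c + d + e)) + e) ^ 2) * hq


theorem toForm_eq_sum_monomial {R : Type*} [CommSemiring R] (d : ℕ) (a : Fin (d+1) → R) :
    toForm R d a = ∑ i : Fin (d+1),
      monomial (Finsupp.single 0 (d - (i : ℕ)) + Finsupp.single 1 (i : ℕ)) (a i) := by
  rw [toForm]
  refine Finset.sum_congr rfl fun i _ => ?_
  rw [X_pow_eq_monomial, X_pow_eq_monomial, mul_assoc, monomial_mul, C_mul_monomial]
  simp

theorem formCoeff_toForm {R : Type*} [CommSemiring R] (d : ℕ) (a : Fin (d+1) → R) :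
    formCoeff R d (toForm R d a) = a := by
  funext j
  rw [formCoeff, toForm_eq_sum_monomial, coeff_sum]
  simp only [coeff_monomial]
  rw [Finset.sum_eq_single j]
  · simp
  · intro i _ hij
    rw [if_neg]
    intro h
    apply hij
    have := DFunLike.congr_fun h 1
    simp at this
    exact Fin.ext this
  · simp

theorem toForm_formCoeff {R : Type*} [CommSemiring R] (d : ℕ) (p : MvPolynomial (Fin 2) R)
    (hp : p.IsHomogeneous d) : toForm R d (formCoeff R d p) = p := by
  ext m
  rw [toForm_eq_sum_monomial, coeff_sum]
  simp only [coeff_monomial, formCoeff]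
  by_cases hm : coeff m p = 0
  · rw [hm]
    apply Finset.sum_eq_zero
    intro i _
    split_ifs with h
    · rw [h, hm]
    · rfl
  · have hd := hp hm
    have hd' : m 0 + m 1 = d := by
      rw [← hd, Finsupp.weight_apply, Finsupp.sum_fintype] <;> simp
    have hm' : Finsupp.single 0 (d - m 1) + Finsupp.single 1 (m 1) = m := by
      ext j
      fin_cases j
      · simp; omega
      · simp
    rw [Finset.sum_eq_single (⟨m 1, by omega⟩ : Fin (d+1))]
    · simp only [hm', if_true]
    · intro i _ hi
      rw [if_neg]
      intro h
      apply hi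
      ext
      simp [← h]
    · simp

theorem toForm_homogeneous {R : Type*} [CommSemiring R] (d : ℕ) (a : Fin (d+1) → R) :
    (toForm R d a).IsHomogeneous d := by
  rw [toForm_eq_sum_monomial]
  apply IsHomogeneous.sum
  intro i _
  apply isHomogeneous_monomial
  rw [map_add, Finsupp.degree_single, Finsupp.degree_single]
  omega

theorem matAct_homogeneous {R : Type*} [CommSemiring R] (d : ℕ) (g : Matrix (Fin 2) (Fin 2) R)
    (p : MvPolynomial (Fin 2) R) (hp : p.IsHomogeneous d) : (matAct R g p).IsHomogeneous d := by
  rw [matAct]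
  have := hp.aeval (fun j : Fin 2 => C (g j 0) * X 0 + C (g j 1) * X 1 : Fin 2 → MvPolynomial (Fin 2) R)
    (n := 1) (fun j => by
      apply IsHomogeneous.add
      · simpa using (isHomogeneous_C (Fin 2) (g j 0)).mul (isHomogeneous_X R (0 : Fin 2))
      · simpa using (isHomogeneous_C (Fin 2) (g j 1)).mul (isHomogeneous_X R (1 : Fin 2)))
  simpa using this

theorem matAct_matAct {R : Type*} [CommSemiring R] (g h : Matrix (Fin 2) (Fin 2) R)
    (p : MvPolynomial (Fin 2) R) : matAct R g (matAct R h p) = matAct R (h * g) p := by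
  simp only [matAct]
  rw [← AlgHom.comp_apply, comp_aeval]
  congr 2
  funext j
  simp [Matrix.mul_apply, Fin.sum_univ_two]
  ring

theorem actCoeff_actCoeff {R : Type*} [CommSemiring R] (d : ℕ) (g h : Matrix (Fin 2) (Fin 2) R)
    (a : Fin (d+1) → R) : actCoeff R d g (actCoeff R d h a) = actCoeff R d (h * g) a := by
  rw [actCoeff, actCoeff, toForm_formCoeff, matAct_matAct, actCoeff]
  exact matAct_homogeneous _ _ _ (toForm_homogeneous _ _)

theorem matAct_one {R : Type*} [CommSemiring R] (p : MvPolynomial (Fin 2) R) :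
    matAct R 1 p = p := by
  rw [matAct]
  conv_rhs => rw [← aeval_X_left_apply p]
  have h : ∀ j : Fin 2, (C ((1 : Matrix (Fin 2) (Fin 2) R) j 0) * X 0 +
      C ((1 : Matrix (Fin 2) (Fin 2) R) j 1) * X 1 : MvPolynomial (Fin 2) R) = X j := by
    rw [Fin.forall_fin_two]
    constructor <;> simp
  rw [funext h]

theorem actCoeff_one {R : Type*} [CommSemiring R] (d : ℕ) (a : Fin (d+1) → R) :
    actCoeff R d 1 a = a := by
  rw [actCoeff, matAct_one, formCoeff_toForm]

theorem matAct_smul {R : Type*} [CommSemiring R] (d : ℕ) (c : R) (g : Matrix (Fin 2) (Fin 2) R)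
    (p : MvPolynomial (Fin 2) R) (hp : p.IsHomogeneous d) :
    matAct R (c • g) p = C (c ^ d) * matAct R g p := by
  rw [← toForm_formCoeff d p hp]
  simp only [matAct, toForm, map_sum, Finset.mul_sum, map_mul, map_pow, aeval_X, aeval_C]
  refine Finset.sum_congr rfl fun i _ => ?_
  have hc : (C c : MvPolynomial (Fin 2) R) ^ d = C c ^ (d - (i : ℕ)) * C c ^ (i : ℕ) := by
    rw [← pow_add]
    congr 1
    omega
  simp only [Matrix.smul_apply, smul_eq_mul, map_mul, mul_assoc, ← mul_add, mul_pow]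
  rw [hc]
  ring

theorem actCoeff_smul {R : Type*} [CommSemiring R] (d : ℕ) (c : R) (g : Matrix (Fin 2) (Fin 2) R)
    (a : Fin (d+1) → R) : actCoeff R d (c • g) a = c ^ d • actCoeff R d g a := by
  funext j
  rw [actCoeff, matAct_smul d c g _ (toForm_homogeneous _ _), formCoeff, coeff_C_mul]
  rfl

theorem map_actCoeff {R S : Type*} [CommRing R] [CommRing S] (f : R →+* S) (d : ℕ)
    (g : Matrix (Fin 2) (Fin 2) R) (a : Fin (d+1) → R) (j : Fin (d+1)) :
    f (actCoeff R d g a j) = actCoeff S d (g.map f) (fun i => f (a i)) j := by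
  rw [actCoeff, formCoeff, ← coeff_map, actCoeff, formCoeff]
  congr 1
  simp only [matAct, toForm, map_sum, map_mul, map_pow, aeval_X, aeval_C]
  refine Finset.sum_congr rfl fun i _ => ?_
  simp [MvPolynomial.algebraMap_eq]

theorem eval_actRing {k : Type*} [CommRing k] (d : ℕ) (g : Matrix (Fin 2) (Fin 2) k)
    (P : MvPolynomial (Fin (d+1)) k) (a : Fin (d+1) → k) :
    eval a (actRing k d g P) = eval (actCoeff k d g a) P := by
  induction P using MvPolynomial.induction_on with
  | C c => simp [actRing]
  | add p q hp hq => simp [hp, hq]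
  | mul_X p i hp =>
    rw [map_mul, map_mul, hp, map_mul, eval_X]
    congr 1
    rw [actRing, aeval_X, map_actCoeff]
    congr 1
    · ext i j; simp
    · simp

/-- The coefficients of the product of six linear forms, over any commutative ring. -/
def sc {R : Type*} [CommRing R] (x y : Fin 6 → R) (j : Fin 7) : R :=
  formCoeff R 6 (∏ i : Fin 6, (C (y i) * X 0 - C (x i) * X 1)) j

theorem map_sc {R S : Type*} [CommRing R] [CommRing S] (f : R →+* S) (x y : Fin 6 → R)
    (j : Fin 7) : f (sc x y j) = sc (fun i => f (x i)) (fun i => f (y i)) j := by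
  rw [sc, formCoeff, ← coeff_map, sc, formCoeff]
  simp

theorem prod_homogeneous {R : Type*} [CommRing R] (x y : Fin 6 → R) :
    (∏ i : Fin 6, (C (y i) * X 0 - C (x i) * X 1) : MvPolynomial (Fin 2) R).IsHomogeneous 6 := by
  have := IsHomogeneous.prod (Finset.univ : Finset (Fin 6))
    (fun i => (C (y i) * X 0 - C (x i) * X 1 : MvPolynomial (Fin 2) R)) (fun _ => 1) (fun i _ => by
      apply IsHomogeneous.sub
      · simpa using (isHomogeneous_C (Fin 2) (y i)).mul (isHomogeneous_X R (0 : Fin 2))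
      · simpa using (isHomogeneous_C (Fin 2) (x i)).mul (isHomogeneous_X R (1 : Fin 2)))
  simpa using this

theorem actCoeff_sc {R : Type*} [CommRing R] (g : Matrix (Fin 2) (Fin 2) R) (x y : Fin 6 → R) :
    actCoeff R 6 g (sc x y) =
      sc (fun i => x i * g 1 1 - y i * g 0 1) (fun i => y i * g 0 0 - x i * g 1 0) := by
  have h : sc x y = formCoeff R 6 (∏ i : Fin 6, (C (y i) * X 0 - C (x i) * X 1)) := rfl
  rw [actCoeff, h, toForm_formCoeff _ _ (prod_homogeneous x y)]
  funext j
  rw [sc]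
  congr 1
  rw [matAct, map_prod]
  refine Finset.prod_congr rfl fun i _ => ?_
  simp [MvPolynomial.algebraMap_eq]
  ring

theorem sc_smul {R : Type*} [CommRing R] (l x y : Fin 6 → R) (j : Fin 7) :
    sc (fun i => l i * x i) (fun i => l i * y i) j = (∏ i, l i) * sc x y j := by
  have h : (∏ i : Fin 6, (C (l i * y i) * X 0 - C (l i * x i) * X 1) : MvPolynomial (Fin 2) R) =
      C (∏ i, l i) * ∏ i : Fin 6, (C (y i) * X 0 - C (x i) * X 1) := by
    rw [map_prod, ← Finset.prod_mul_distrib]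
    refine Finset.prod_congr rfl fun i _ => ?_
    rw [C_mul, C_mul]
    ring
  unfold sc formCoeff
  rw [h, coeff_C_mul]

theorem sc_perm {R : Type*} [CommRing R] (π : Equiv.Perm (Fin 6)) (x y : Fin 6 → R) :
    sc (fun i => x (π i)) (fun i => y (π i)) = sc x y := by
  have h := Equiv.prod_comp π (fun i => (C (y i) * X 0 - C (x i) * X 1 : MvPolynomial (Fin 2) R))
  funext j
  unfold sc
  rw [h]


/-- `τ` acts on the Joubert functions through a permutation of the points, up to scaling. -/
def XiPerm (k : Type*) [CommRing k] (τ : Equiv.Perm (Fin 6)) : Prop :=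
  ∃ π : Equiv.Perm (Fin 6), ∃ ε : k, ε * ε = 1 ∧ ∀ x y : Fin 6 → k, ∀ a : Fin 6,
    xi (fun i => x (π i)) (fun i => y (π i)) a = ε * xi x y (τ a)

theorem XiPerm_mul {k : Type*} [CommRing k] {σ τ : Equiv.Perm (Fin 6)}
    (h1 : XiPerm k σ) (h2 : XiPerm k τ) : XiPerm k (σ * τ) := by
  obtain ⟨π, ε, he, h⟩ := h1
  obtain ⟨π', ε', he', h'⟩ := h2
  refine ⟨π * π', ε * ε', by linear_combination ε' * ε' * he + he', fun x y a => ?_⟩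
  have e1 := h' (fun i => x (π i)) (fun i => y (π i)) a
  have e2 := h x y (τ a)
  simp only [Equiv.Perm.mul_apply]
  rw [e1, e2]
  ring

theorem XiPerm_one {k : Type*} [CommRing k] : XiPerm k 1 :=
  ⟨1, 1, by ring, fun x y a => by simp⟩

theorem XiPerm_swap {k : Type*} [CommRing k] (i : Fin 5) :
    XiPerm k (Equiv.swap i.castSucc i.succ) := by
  have key : ∀ (π τ : Equiv.Perm (Fin 6)),
      (∀ x y : Fin 6 → k, ∀ a : Fin 6,
      xi (fun i => x (π i)) (fun i => y (π i)) a = -1 * xi x y (τ a)) → XiPerm k τ :=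
    fun π τ h => ⟨π, -1, by ring, h⟩
  fin_cases i
  · refine key (Equiv.swap 0 1 * Equiv.swap 2 3 * Equiv.swap 4 5) _ fun x y a => ?_
    fin_cases a <;> simp [xi, Dij, Equiv.swap_apply_def] <;> ring
  · refine key (Equiv.swap 0 3 * Equiv.swap 1 4 * Equiv.swap 2 5) _ fun x y a => ?_
    fin_cases a <;> simp [xi, Dij, Equiv.swap_apply_def] <;> ring
  · refine key (Equiv.swap 0 1 * Equiv.swap 2 4 * Equiv.swap 3 5) _ fun x y a => ?_
    fin_cases a <;> simp [xi, Dij, Equiv.swap_apply_def] <;> ring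
  · refine key (Equiv.swap 0 5 * Equiv.swap 1 4 * Equiv.swap 2 3) _ fun x y a => ?_
    fin_cases a <;> simp [xi, Dij, Equiv.swap_apply_def] <;> ring
  · refine key (Equiv.swap 0 1 * Equiv.swap 2 5 * Equiv.swap 3 4) _ fun x y a => ?_
    fin_cases a <;> simp [xi, Dij, Equiv.swap_apply_def] <;> ring

theorem XiPerm_all {k : Type*} [CommRing k] (τ : Equiv.Perm (Fin 6)) : XiPerm k τ := by
  have h : τ ∈ Submonoid.closure (Set.range fun i : Fin 5 ↦ Equiv.swap i.castSucc i.succ) := by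
    rw [Equiv.Perm.mclosure_swap_castSucc_succ]; trivial
  induction h using Submonoid.closure_induction with
  | mem x hx =>
    obtain ⟨i, rfl⟩ := hx
    exact XiPerm_swap i
  | one => exact XiPerm_one
  | mul x y _ _ hx hy => exact XiPerm_mul hx hy

/-- First coordinates of the normalized points. -/
def nfx {R : Type*} [CommRing R] (z : Fin 6 → R) : Fin 6 → R :=
  ![0, -1, 1, z 3 + z 5, -(z 1 + z 4), z 0 + z 2]

/-- Second coordinates of the normalized points. -/
def nfy {R : Type*} [CommRing R] (z : Fin 6 → R) : Fin 6 → R :=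
  ![1, 0, 1, -(z 2 + z 4), z 0 + z 5, -(z 1 + z 3)]

/-- The normal form of a sextic with Joubert functions `z`. -/
def pt {R : Type*} [CommRing R] (z : Fin 6 → R) : Fin 7 → R := sc (nfx z) (nfy z)

theorem map_pt {R S : Type*} [CommRing R] [CommRing S] (f : R →+* S) (z : Fin 6 → R)
    (j : Fin 7) : f (pt z j) = pt (fun i => f (z i)) j := by
  rw [pt, map_sc, pt]
  congr 1
  · funext i; fin_cases i <;> simp [nfx]
  · funext i; fin_cases i <;> simp [nfy]

theorem nf_equiv0 {k : Type*} [CommRing k] (x y : Fin 6 → k) (t : k) (j : Fin 7) :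
    actCoeff k 6 !![Dij x y 1 2 * y 0, - Dij x y 1 2 * x 0; Dij x y 0 2 * y 1, - Dij x y 0 2 * x 1]
      (pt (fun i => t * xi x y i)) j =
    (∏ i, (![Dij x y 1 2, Dij x y 0 2, - Dij x y 0 1,
      -4 * t * Dij x y 4 5 * Dij x y 0 2 * Dij x y 1 2 * Dij x y 0 1,
      -4 * t * Dij x y 3 5 * Dij x y 0 2 * Dij x y 1 2 * Dij x y 0 1,
      -4 * t * Dij x y 3 4 * Dij x y 0 2 * Dij x y 1 2 * Dij x y 0 1] : Fin 6 → k) i) *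
    sc x y j := by
  have h35 := xi_add_35 x y
  have h14 := xi_add_14 x y
  have h02 := xi_add_02 x y
  have h24 := xi_add_24 x y
  have h05 := xi_add_05 x y
  have h13 := xi_add_13 x y
  rw [← sc_smul, pt, actCoeff_sc]
  have hx : nfx (fun i => t * xi x y i) = ![0, -1, 1, t * (xi x y 3 + xi x y 5),
      -t * (xi x y 1 + xi x y 4), t * (xi x y 0 + xi x y 2)] := by
    funext i; fin_cases i <;> simp [nfx] <;> ring
  have hy : nfy (fun i => t * xi x y i) = ![1, 0, 1, -t * (xi x y 2 + xi x y 4),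
      t * (xi x y 0 + xi x y 5), -t * (xi x y 1 + xi x y 3)] := by
    funext i; fin_cases i <;> simp [nfy] <;> ring
  rw [hx, hy, h35, h14, h02, h24, h05, h13]
  congr 1
  · funext i; fin_cases i <;> simp [Dij] <;> ring
  · funext i; fin_cases i <;> simp [Dij] <;> ring

theorem nf_equiv {k : Type*} [Field k] [IsAlgClosed k] (h2 : (2 : k) ≠ 0) (x y : Fin 6 → k) (t : k)
    (ht : t ≠ 0) (hD : sqrtDisc x y ≠ 0) :
    ∃ g : GL (Fin 2) k, actCoeff k 6 (g : Matrix (Fin 2) (Fin 2) k)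
      (pt (fun i => t * xi x y i)) = sc x y := by
  simp only [sqrtDisc, ne_eq, mul_eq_zero, not_or] at hD
  obtain ⟨⟨⟨⟨⟨⟨⟨⟨⟨⟨⟨⟨⟨⟨d01, d02⟩, d03⟩, d04⟩, d05⟩, d12⟩, d13⟩, d14⟩, d15⟩, d23⟩, d24⟩, d25⟩,
    d34⟩, d35⟩, d45⟩ := hD
  have h4 : (4 : k) ≠ 0 := by
    rw [show (4 : k) = 2 ^ 2 by norm_num]; exact pow_ne_zero _ h2
  have h := nf_equiv0 x y t
  set lam : k := ∏ i, (![Dij x y 1 2, Dij x y 0 2, - Dij x y 0 1,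
      -4 * t * Dij x y 4 5 * Dij x y 0 2 * Dij x y 1 2 * Dij x y 0 1,
      -4 * t * Dij x y 3 5 * Dij x y 0 2 * Dij x y 1 2 * Dij x y 0 1,
      -4 * t * Dij x y 3 4 * Dij x y 0 2 * Dij x y 1 2 * Dij x y 0 1] : Fin 6 → k) i with hl
  have hlam : lam ≠ 0 := by
    rw [hl, Fin.prod_univ_six]
    simp [d01, d02, d12, d45, d35, d34, ht, h4]
  obtain ⟨μ, hμ⟩ := IsAlgClosed.exists_pow_nat_eq lam (n := 6) (by norm_num)
  have hμ0 : μ ≠ 0 := by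
    rintro rfl
    apply hlam
    rw [← hμ]; simp
  set g0 : Matrix (Fin 2) (Fin 2) k :=
    !![Dij x y 1 2 * y 0, - Dij x y 1 2 * x 0; Dij x y 0 2 * y 1, - Dij x y 0 2 * x 1] with hg0
  have hdet0 : g0.det = Dij x y 1 2 * Dij x y 0 2 * Dij x y 0 1 := by
    rw [hg0, Matrix.det_fin_two_of]
    simp only [Dij]; ring
  have hdet : (μ⁻¹ • g0).det ≠ 0 := by
    rw [Matrix.det_smul, hdet0]
    exact mul_ne_zero (pow_ne_zero _ (inv_ne_zero hμ0)) (mul_ne_zero (mul_ne_zero d12 d02) d01)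
  refine ⟨Matrix.GeneralLinearGroup.mkOfDetNeZero _ hdet, ?_⟩
  change actCoeff k 6 (μ⁻¹ • g0) _ = _
  rw [actCoeff_smul]
  funext j
  rw [Pi.smul_apply, h j, ← hμ, smul_eq_mul, ← mul_assoc, ← mul_pow, inv_mul_cancel₀ hμ0]
  simp

theorem actRing_inv_left {k : Type*} [Field k] [Infinite k] (g : GL (Fin 2) k)
    (P : MvPolynomial (Fin 7) k) :
    actRing k 6 ((g⁻¹ : GL (Fin 2) k) : Matrix (Fin 2) (Fin 2) k)
      (actRing k 6 (g : Matrix (Fin 2) (Fin 2) k) P) = P := by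
  apply MvPolynomial.funext
  intro a
  rw [eval_actRing, eval_actRing, actCoeff_actCoeff]
  rw [← Matrix.GeneralLinearGroup.coe_mul]
  simp [actCoeff_one]

theorem actRing_inv_right {k : Type*} [Field k] [Infinite k] (g : GL (Fin 2) k)
    (P : MvPolynomial (Fin 7) k) :
    actRing k 6 (g : Matrix (Fin 2) (Fin 2) k)
      (actRing k 6 ((g⁻¹ : GL (Fin 2) k) : Matrix (Fin 2) (Fin 2) k) P) = P := by
  have := actRing_inv_left g⁻¹ P
  rwa [inv_inv] at this

theorem actRing_ne_zero {k : Type*} [Field k] [Infinite k] (g : GL (Fin 2) k)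
    (P : MvPolynomial (Fin 7) k) (hP : P ≠ 0) :
    actRing k 6 (g : Matrix (Fin 2) (Fin 2) k) P ≠ 0 := by
  intro h
  apply hP
  rw [← actRing_inv_left g P, h, map_zero]

theorem semi_invariant {k : Type*} [Field k] [Infinite k] (p q : MvPolynomial (Fin 7) k)
    (hq : q ≠ 0) (hpq : IsRelPrime p q)
    (H : ∀ g : GL (Fin 2) k, p * actRing k 6 (g : Matrix (Fin 2) (Fin 2) k) q =
      q * actRing k 6 (g : Matrix (Fin 2) (Fin 2) k) p) (g : GL (Fin 2) k) :
    ∃ c : k, c ≠ 0 ∧ actRing k 6 (g : Matrix (Fin 2) (Fin 2) k) q = C c * q ∧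
      actRing k 6 (g : Matrix (Fin 2) (Fin 2) k) p = C c * p := by
  have hdvd : ∀ g : GL (Fin 2) k, q ∣ actRing k 6 (g : Matrix (Fin 2) (Fin 2) k) q := fun g =>
    hpq.symm.dvd_of_dvd_mul_left (Dvd.intro _ (H g).symm)
  have h1 := hdvd g
  have h2 : actRing k 6 (g : Matrix (Fin 2) (Fin 2) k) q ∣ q := by
    have := map_dvd (actRing k 6 (g : Matrix (Fin 2) (Fin 2) k)) (hdvd g⁻¹)
    rwa [actRing_inv_right] at this
  obtain ⟨u, hu⟩ := associated_of_dvd_dvd h1 h2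
  obtain ⟨c, hc, hcu⟩ := MvPolynomial.isUnit_iff_eq_C_of_isReduced.mp u.isUnit
  refine ⟨c, hc.ne_zero, ?_, ?_⟩
  · rw [← hu, hcu, mul_comm]
  · apply mul_left_cancel₀ hq
    rw [← H g, ← hu, hcu]
    ring


theorem sqrtDisc_sq {k : Type*} [Field k] (x y : Fin 6 → k) :
    sqrtDisc x y ^ 2 = I10r x y := by
  rw [I10r, Finset.prod_filter, Fintype.prod_prod_type]
  simp only [Fin.prod_univ_six]
  simp only [Fin.isValue, Fin.reduceLT, if_true, if_false, lt_self_iff_false]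
  rw [sqrtDisc]
  ring

/-- The vector of elementary symmetric functions. -/
def esv {k : Type*} [CommRing k] (z : Fin 6 → k) : Fin 6 → k :=
  ![es1 z, es2 z, es3 z, es4 z, es5 z, es6 z]

theorem eval_esv {k : Type*} [CommRing k] (z : Fin 6 → k) (P : MvPolynomial (Fin 6) k) :
    eval z (aeval (fun i : Fin 6 => esymm (Fin 6) k (i + 1)) P) = eval (esv z) P := by
  induction P using MvPolynomial.induction_on with
  | C c => simp
  | add p q hp hq => rw [map_add, map_add, hp, hq, map_add]
  | mul_X p i hp =>
    rw [map_mul, map_mul, hp, map_mul, eval_X, aeval_X]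
    congr 1
    fin_cases i
    · exact eval_esymm1 z
    · exact eval_esymm2 z
    · exact eval_esymm3 z
    · exact eval_esymm4 z
    · exact eval_esymm5 z
    · exact eval_esymm6 z

theorem symm_exists {k : Type*} [CommRing k] (P : MvPolynomial (Fin 6) k) (hP : P.IsSymmetric) :
    ∃ Q : MvPolynomial (Fin 6) k, ∀ z, eval (esv z) Q = eval z P := by
  obtain ⟨Q, hQ⟩ := esymmAlgHom_surjective (σ := Fin 6) (n := 6) k (by simp) ⟨P, hP⟩
  refine ⟨Q, fun z => ?_⟩
  rw [← eval_esv, ← esymmAlgHom_apply, hQ]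

theorem rename_perm_mul {k : Type*} [CommRing k] (e τ : Equiv.Perm (Fin 6))
    (P : MvPolynomial (Fin 6) k) : rename e (rename τ P) = rename (e * τ : Equiv.Perm (Fin 6)) P := by
  rw [rename_rename]
  rfl

/-- Pullback of a polynomial to the space of Joubert functions. -/
def pull {k : Type*} [CommRing k] (P : MvPolynomial (Fin 7) k) : MvPolynomial (Fin 6) k :=
  aeval (pt (X : Fin 6 → MvPolynomial (Fin 6) k)) P

theorem eval_pull {k : Type*} [CommRing k] (P : MvPolynomial (Fin 7) k) (z : Fin 6 → k) :
    eval z (pull P) = eval (pt z) P := by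
  rw [pull]
  induction P using MvPolynomial.induction_on with
  | C c => simp
  | add p q hp hq => rw [map_add, map_add, hp, hq, map_add]
  | mul_X p i hp =>
    rw [map_mul, map_mul, hp, map_mul, eval_X, aeval_X, map_pt]
    simp

theorem prod_shift {G k : Type*} [Group G] [Fintype G] [DecidableEq G] [CommRing k] (f : G → k)
    (g : G) : f g * ∏ h ∈ Finset.univ.erase 1, f (g * h) = ∏ h, f h := by
  rw [← Equiv.prod_comp (Equiv.mulLeft g) f,
    ← Finset.mul_prod_erase Finset.univ _ (Finset.mem_univ (1 : G))]
  simp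

theorem sum_perm_const {k : Type*} [CommRing k] (c : k) :
    ∑ _τ : Equiv.Perm (Fin 6), c = 720 * c := by
  rw [Finset.sum_const, Finset.card_univ, Fintype.card_perm, Fintype.card_fin, nsmul_eq_mul]
  norm_num [Nat.factorial]

theorem symm_part {k : Type*} [Field k] (p q : MvPolynomial (Fin 7) k) :
    ∃ N S : MvPolynomial (Fin 6) k, ∀ (z : Fin 6 → k) (v : k),
      (∀ τ : Equiv.Perm (Fin 6), eval (pt (z ∘ τ)) q ≠ 0 ∧
        v * eval (pt (z ∘ τ)) q = eval (pt (z ∘ τ)) p) →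
      eval (esv z) N ≠ 0 ∧ eval (esv z) S = 720 * v * eval (esv z) N := by
  obtain ⟨N, hN⟩ := symm_exists (∏ τ : Equiv.Perm (Fin 6), rename τ (pull q)) (by
    intro e
    rw [map_prod]
    simp only [rename_perm_mul]
    exact Equiv.prod_comp (Equiv.mulLeft e) (fun τ : Equiv.Perm (Fin 6) => rename τ (pull q)))
  set R : MvPolynomial (Fin 6) k :=
    pull p * ∏ τ ∈ (Finset.univ : Finset (Equiv.Perm (Fin 6))).erase 1, rename τ (pull q) with hR
  obtain ⟨S, hS⟩ := symm_exists (∑ τ : Equiv.Perm (Fin 6), rename τ R) (by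
    intro e
    rw [map_sum]
    simp only [rename_perm_mul]
    exact Equiv.sum_comp (Equiv.mulLeft e) (fun τ : Equiv.Perm (Fin 6) => rename τ R))
  refine ⟨N, S, fun z v h => ?_⟩
  have hNz : eval (esv z) N = ∏ τ : Equiv.Perm (Fin 6), eval (pt (z ∘ τ)) q := by
    rw [hN, map_prod]
    simp only [eval_rename, eval_pull]
  refine ⟨?_, ?_⟩
  · rw [hNz]
    exact Finset.prod_ne_zero_iff.mpr fun τ _ => (h τ).1
  · rw [hS, map_sum]
    have key : ∀ τ : Equiv.Perm (Fin 6), eval z (rename τ R) = v * eval (esv z) N := by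
      intro τ
      rw [eval_rename, hR, map_mul, map_prod, eval_pull, ← (h τ).2, hNz]
      simp only [eval_rename, eval_pull]
      have hp := prod_shift (fun τ : Equiv.Perm (Fin 6) => eval (pt (z ∘ τ)) q) τ
      simp only [Equiv.Perm.coe_mul, ← Function.comp_assoc] at hp
      rw [mul_assoc, hp]
    rw [Finset.sum_congr rfl (fun τ _ => key τ), sum_perm_const, mul_assoc]

theorem sqrtDisc_perm {k : Type*} [Field k] (P10 : MvPolynomial (Fin 7) k)
    (he10 : ∀ x y : Fin 6 → k, eval (sexticCoeff x y) P10 = I10r x y)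
    (x y : Fin 6 → k) (π : Equiv.Perm (Fin 6)) (hD : sqrtDisc x y ≠ 0) :
    sqrtDisc (fun i => x (π i)) (fun i => y (π i)) ≠ 0 := by
  have h1 := he10 x y
  have h2 := he10 (fun i => x (π i)) (fun i => y (π i))
  rw [← sqrtDisc_sq] at h1 h2
  change eval (sc x y) P10 = _ at h1
  change eval (sc _ _) P10 = _ at h2
  rw [sc_perm, h1] at h2
  intro h0
  rw [h0] at h2
  apply hD
  simpa using h2

theorem core_point {k : Type*} [Field k] [IsAlgClosed k] (h2 : (2 : k) ≠ 0)
    (P10 : MvPolynomial (Fin 7) k)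
    (he10 : ∀ x y : Fin 6 → k, eval (sexticCoeff x y) P10 = I10r x y)
    (p q : MvPolynomial (Fin 7) k) (hq : q ≠ 0) (hpq : IsRelPrime p q)
    (H : ∀ g : GL (Fin 2) k, p * actRing k 6 (g : Matrix (Fin 2) (Fin 2) k) q =
      q * actRing k 6 (g : Matrix (Fin 2) (Fin 2) k) p)
    (x y : Fin 6 → k) (hD : sqrtDisc x y ≠ 0) (t : k) (ht : t ≠ 0)
    (hqa : eval (sc x y) q ≠ 0) (v : k) (hv : v * eval (sc x y) q = eval (sc x y) p)
    (τ : Equiv.Perm (Fin 6)) :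
    eval (pt ((fun i => t * xi x y i) ∘ τ)) q ≠ 0 ∧
      v * eval (pt ((fun i => t * xi x y i) ∘ τ)) q =
        eval (pt ((fun i => t * xi x y i) ∘ τ)) p := by
  have : Infinite k := IsAlgClosed.instInfinite
  obtain ⟨π, ε, hε, hx⟩ := XiPerm_all (k := k) τ
  have hε0 : ε ≠ 0 := by
    rintro rfl
    simp at hε
  have hz : ((fun i => t * xi x y i) ∘ τ) =
      fun i => (t * ε) * xi (fun i => x (π i)) (fun i => y (π i)) i := by
    funext i
    simp only [Function.comp, hx]
    linear_combination (-(t * xi x y (τ i))) * hε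
  obtain ⟨g, hg⟩ := nf_equiv h2 (fun i => x (π i)) (fun i => y (π i)) (t * ε)
    (mul_ne_zero ht hε0) (sqrtDisc_perm P10 he10 x y π hD)
  rw [← hz, sc_perm] at hg
  obtain ⟨c, hc, hcq, hcp⟩ := semi_invariant p q hq hpq H g
  have e1 := congrArg (eval (pt ((fun i => t * xi x y i) ∘ τ))) hcq
  have e2 := congrArg (eval (pt ((fun i => t * xi x y i) ∘ τ))) hcp
  rw [eval_actRing, hg, map_mul, eval_C] at e1 e2
  rw [e1] at hqa hv
  rw [e2] at hv
  refine ⟨right_ne_zero_of_mul hqa, mul_left_cancel₀ hc ?_⟩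
  linear_combination hv

theorem esv_smul {k : Type*} [CommRing k] (t : k) (z : Fin 6 → k) :
    esv (fun i => t * z i) =
      ![t * es1 z, t^2 * es2 z, t^3 * es3 z, t^4 * es4 z, t^5 * es5 z, t^6 * es6 z] := by
  funext i
  fin_cases i
  · simp [esv, es1]; ring
  · simp [esv, es2]; ring
  · simp [esv, es3]; ring
  · simp [esv, es4]; ring
  · simp [esv, es5]; ring
  · simp [esv, es6]; ring

/-- The elementary symmetric functions of the normalized Joubert functions in terms of
the absolute invariants. -/
def sv {K : Type*} [Field K] (T1 T2 T3 : K) : Fin 6 → K :=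
  ![0, 4 / T3, 0, (44 / 15 + 4 / 15 * T1) / T3 ^ 2, 1024 / T3 ^ 2,
    (208 / 75 - 16 / 75 * T1 + 1024 / 25 * T2) / T3 ^ 3]

theorem esv_xi {k : Type*} [Field k] (h2 : (2 : k) ≠ 0) (h3 : (3 : k) ≠ 0) (h5 : (5 : k) ≠ 0)
    (x y : Fin 6 → k) (hD : sqrtDisc x y ≠ 0) (hI : I2r x y ≠ 0) :
    esv (fun i => (I2r x y ^ 2 / sqrtDisc x y) * xi x y i) =
      sv (I4r x y / I2r x y ^ 2) (I6r x y / I2r x y ^ 3) (I10r x y / I2r x y ^ 5) := by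
  have h9 : (9 : k) ≠ 0 := by
    rw [show (9 : k) = 3 ^ 2 by norm_num]; exact pow_ne_zero _ h3
  have h15 : (15 : k) ≠ 0 := by
    rw [show (15 : k) = 3 * 5 by norm_num]; exact mul_ne_zero h3 h5
  have h25 : (25 : k) ≠ 0 := by
    rw [show (25 : k) = 5 ^ 2 by norm_num]; exact pow_ne_zero _ h5
  have h75 : (75 : k) ≠ 0 := by
    rw [show (75 : k) = 3 * 5 ^ 2 by norm_num]; exact mul_ne_zero h3 (pow_ne_zero _ h5)
  have h108 : (108 : k) ≠ 0 := by
    rw [show (108 : k) = 2 ^ 2 * 3 ^ 3 by norm_num]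
    exact mul_ne_zero (pow_ne_zero _ h2) (pow_ne_zero _ h3)
  have hB := sumB_eq h2 h3 x y
  have hC := sumC_eq h2 h3 x y
  have e2 := xi_es2 h2 h3 x y
  have e5 := xi_es5 x y
  have e4 : es4 (xi x y) = 44 / 15 * I2r x y ^ 2 + 4 / 15 * I4r x y := by
    have h := I4r.eq_1 x y
    rw [e2] at hB
    rw [h]
    field_simp
    linear_combination 5 * hB
  have e6 : es6 (xi x y) = 208 / 75 * I2r x y ^ 3 - 16 / 75 * I2r x y * I4r x y +
      1024 / 25 * I6r x y := by
    have h : 108 * I6r x y = 13 * I2r x y ^ 3 - I2r x y * I4r x y + 300 * sumC x y := by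
      rw [I6r]
      field_simp
      ring
    have e4' : 15 * es4 (xi x y) = 44 * I2r x y ^ 2 + 4 * I4r x y := by
      rw [e4]
      field_simp
    rw [e2] at hC
    have h' : 75 * es6 (xi x y) = 208 * I2r x y ^ 3 - 16 * I2r x y * I4r x y +
        3072 * I6r x y := by
      apply mul_left_cancel₀ h108
      linear_combination (-3072) * h - 900 * hC - 1200 * I2r x y * e4'
    field_simp
    linear_combination 25 * h'
  rw [esv_smul, xi_es1, xi_es3, e2, e4, e5, e6, ← sqrtDisc_sq, sv]
  have hS : sqrtDisc x y ^ 2 ≠ 0 := pow_ne_zero _ hD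
  funext i
  fin_cases i
  · simp
  · simp; field_simp
  · simp
  · simp; field_simp
  · simp; field_simp
  · simp; field_simp


/-- Dehomogenization of binary forms. -/
def dehom (k : Type*) [CommRing k] : MvPolynomial (Fin 2) k →ₐ[k] Polynomial k :=
  aeval ![Polynomial.X, 1]

theorem dehom_toForm {k : Type*} [CommRing k] (a : Fin 7 → k) :
    dehom k (toForm k 6 a) = ∑ i : Fin 7, Polynomial.C (a i) * Polynomial.X ^ (6 - (i : ℕ)) := by
  simp only [dehom, toForm, map_sum, map_mul, map_pow, aeval_X]
  refine Finset.sum_congr rfl fun i _ => ?_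
  have : (aeval ![Polynomial.X, (1 : Polynomial k)]) (C (a i) : MvPolynomial (Fin 2) k) =
    Polynomial.C (a i) := by rw [aeval_C]; rfl
  rw [this]
  simp

theorem dehom_coeff {k : Type*} [CommRing k] (a : Fin 7 → k) (j : Fin 7) :
    (∑ i : Fin 7, Polynomial.C (a i) * Polynomial.X ^ (6 - (i : ℕ))).coeff (6 - (j : ℕ)) = a j := by
  rw [Polynomial.finsetSum_coeff]
  simp only [Polynomial.coeff_C_mul_X_pow]
  rw [Finset.sum_eq_single j]
  · simp
  · intro i _ hij
    rw [if_neg]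
    intro h
    apply hij
    ext
    omega
  · simp

theorem sc_of_dehom {k : Type*} [CommRing k] (a : Fin 7 → k) (x y : Fin 6 → k)
    (h : (∑ i : Fin 7, Polynomial.C (a i) * Polynomial.X ^ (6 - (i : ℕ)) : Polynomial k) =
      ∏ i : Fin 6, (Polynomial.C (y i) * Polynomial.X - Polynomial.C (x i))) : sc x y = a := by
  have h1 : dehom k (∏ i : Fin 6, (C (y i) * X 0 - C (x i) * X 1)) =
      ∏ i : Fin 6, (Polynomial.C (y i) * Polynomial.X - Polynomial.C (x i)) := by
    rw [map_prod]
    refine Finset.prod_congr rfl fun i _ => ?_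
    have hC : ∀ c : k, (dehom k) (C c : MvPolynomial (Fin 2) k) = Polynomial.C c := fun c => by
      rw [dehom, aeval_C]; rfl
    rw [map_sub, map_mul, map_mul, hC, hC]
    simp [dehom]
  rw [← toForm_formCoeff 6 _ (prod_homogeneous x y), ← h, dehom_toForm] at h1
  funext j
  rw [← dehom_coeff a j, ← h1, dehom_coeff]
  rfl

theorem exists_roots {k : Type*} [Field k] [IsAlgClosed k] (a : Fin 7 → k) (ha : a 0 ≠ 0) :
    ∃ x y : Fin 6 → k, sc x y = a := by
  set f : Polynomial k := ∑ i : Fin 7, Polynomial.C (a i) * Polynomial.X ^ (6 - (i : ℕ)) with hf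
  have hc6 : f.coeff 6 = a 0 := dehom_coeff a 0
  have hle : f.natDegree ≤ 6 := by
    apply Polynomial.natDegree_sum_le_of_forall_le
    intro i _
    refine (Polynomial.natDegree_C_mul_X_pow_le _ _).trans (by omega)
  have hdeg : f.natDegree = 6 :=
    le_antisymm hle (Polynomial.le_natDegree_of_ne_zero (by rw [hc6]; exact ha))
  have hlead : f.leadingCoeff = a 0 := by rw [Polynomial.leadingCoeff, hdeg, hc6]
  have hs := IsAlgClosed.splits f
  have hcard : f.roots.card = 6 := by rw [← hs.natDegree_eq_card_roots, hdeg]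
  have hprod := hs.eq_prod_roots
  rw [hlead] at hprod
  obtain ⟨l, hl⟩ := Quot.exists_rep f.roots
  change (l : Multiset k) = f.roots at hl
  rw [← hl] at hcard hprod
  simp only [Multiset.coe_card] at hcard
  match l, hcard with
  | [r0, r1, r2, r3, r4, r5], _ =>
    refine ⟨![a 0 * r0, r1, r2, r3, r4, r5], ![a 0, 1, 1, 1, 1, 1], sc_of_dehom _ _ _ ?_⟩
    rw [← hf, hprod, Fin.prod_univ_six]
    simp
    ring

theorem P2_ne {k : Type*} [Field k] (h2 : (2 : k) ≠ 0) (h3 : (3 : k) ≠ 0)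
    (P2 : MvPolynomial (Fin 7) k)
    (he2 : ∀ x y : Fin 6 → k, eval (sexticCoeff x y) P2 = I2r x y) : P2 ≠ 0 := by
  rintro rfl
  have h := he2 ![1, 1, 1, 0, 0, 0] ![0, 0, 0, 1, 1, 1]
  have h48 : (48 : k) ≠ 0 := by
    rw [show (48 : k) = 2 ^ 4 * 3 by norm_num]; exact mul_ne_zero (pow_ne_zero _ h2) h3
  rw [I2r, sumPairs, perm_pairs (fun i j => Dij _ _ i j ^ 2) (Dij_sq_symm _ _)] at h
  simp [Dij, h2, h48] at h
  apply h3
  have h6 : (2 : k) * 3 = 0 := by linear_combination h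
  exact (mul_eq_zero.mp h6).resolve_left h2

theorem P10_ne {k : Type*} [Field k] (h2 : (2 : k) ≠ 0) (h3 : (3 : k) ≠ 0) (h5 : (5 : k) ≠ 0)
    (P10 : MvPolynomial (Fin 7) k)
    (he10 : ∀ x y : Fin 6 → k, eval (sexticCoeff x y) P10 = I10r x y) : P10 ≠ 0 := by
  rintro rfl
  have h := he10 ![0, 1, 2, 3, 4, 5] ![1, 1, 1, 1, 1, 1]
  rw [← sqrtDisc_sq, map_zero] at h
  have h' := pow_eq_zero_iff (two_ne_zero) |>.mp h.symm
  have h4 : (4 : k) ≠ 0 := by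
    rw [show (4 : k) = 2 ^ 2 by norm_num]; exact pow_ne_zero _ h2
  simp only [sqrtDisc, Dij] at h'
  simp at h'
  norm_num [h2, h3, h4, h5] at h'

section
variable {k : Type*} [Field k]

/-- The rational function `z` takes the value `v` at `a`. -/
def Ev (a : Fin 7 → k) (z : FractionRing (MvPolynomial (Fin 7) k)) (v : k) : Prop :=
  ∃ n d : MvPolynomial (Fin 7) k, eval a d ≠ 0 ∧
    z * algebraMap (MvPolynomial (Fin 7) k) (FractionRing (MvPolynomial (Fin 7) k)) d =
      algebraMap (MvPolynomial (Fin 7) k) (FractionRing (MvPolynomial (Fin 7) k)) n ∧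
    v * eval a d = eval a n

theorem Ev.poly (a : Fin 7 → k) (P : MvPolynomial (Fin 7) k) :
    Ev a (algebraMap _ _ P) (eval a P) := ⟨P, 1, by simp, by simp, by simp⟩

theorem Ev.const (a : Fin 7 → k) (c : k) :
    Ev a (algebraMap k _ c) c := by
  have := Ev.poly a (C c)
  rw [eval_C] at this
  rwa [IsScalarTower.algebraMap_apply k (MvPolynomial (Fin 7) k)]

theorem Ev.ofNat (a : Fin 7 → k) (n : ℕ) [n.AtLeastTwo] :
    Ev a (OfNat.ofNat n) (OfNat.ofNat n : k) := by
  have := Ev.const a (OfNat.ofNat n : k)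
  rwa [map_ofNat] at this

theorem Ev.zero (a : Fin 7 → k) : Ev a 0 (0 : k) := by
  have := Ev.const a (0 : k)
  rwa [map_zero] at this

theorem Ev.add {a : Fin 7 → k} {z w : FractionRing (MvPolynomial (Fin 7) k)} {u v : k}
    (h1 : Ev a z u) (h2 : Ev a w v) : Ev a (z + w) (u + v) := by
  obtain ⟨n, d, hd, e, f⟩ := h1
  obtain ⟨n', d', hd', e', f'⟩ := h2
  refine ⟨n * d' + n' * d, d * d', ?_, ?_, ?_⟩
  · rw [map_mul]; exact mul_ne_zero hd hd'
  · simp only [map_mul, map_add]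
    rw [← e, ← e']; ring
  · simp only [map_mul, map_add]
    rw [← f, ← f']; ring

theorem Ev.mul {a : Fin 7 → k} {z w : FractionRing (MvPolynomial (Fin 7) k)} {u v : k}
    (h1 : Ev a z u) (h2 : Ev a w v) : Ev a (z * w) (u * v) := by
  obtain ⟨n, d, hd, e, f⟩ := h1
  obtain ⟨n', d', hd', e', f'⟩ := h2
  refine ⟨n * n', d * d', ?_, ?_, ?_⟩
  · rw [map_mul]; exact mul_ne_zero hd hd'
  · simp only [map_mul]
    rw [← e, ← e']; ring
  · simp only [map_mul]
    rw [← f, ← f']; ring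

theorem Ev.inv {a : Fin 7 → k} {z : FractionRing (MvPolynomial (Fin 7) k)} {u : k}
    (h1 : Ev a z u) (hu : u ≠ 0) : Ev a z⁻¹ u⁻¹ := by
  obtain ⟨n, d, hd, e, f⟩ := h1
  have hn : eval a n ≠ 0 := by rw [← f]; exact mul_ne_zero hu hd
  have hz : z ≠ 0 := by
    rintro rfl
    rw [zero_mul, eq_comm, map_eq_zero_iff _ (IsFractionRing.injective _ _)] at e
    rw [e] at hn
    simp at hn
  refine ⟨d, n, hn, ?_, ?_⟩
  · rw [← e, inv_mul_cancel_left₀ hz]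
  · rw [← f, inv_mul_cancel_left₀ hu]

theorem Ev.div {a : Fin 7 → k} {z w : FractionRing (MvPolynomial (Fin 7) k)} {u v : k}
    (h1 : Ev a z u) (h2 : Ev a w v) (hv : v ≠ 0) : Ev a (z / w) (u / v) := by
  rw [div_eq_mul_inv, div_eq_mul_inv]
  exact h1.mul (h2.inv hv)

theorem Ev.neg {a : Fin 7 → k} {z : FractionRing (MvPolynomial (Fin 7) k)} {u : k}
    (h1 : Ev a z u) : Ev a (-z) (-u) := by
  obtain ⟨n, d, hd, e, f⟩ := h1
  refine ⟨-n, d, hd, ?_, ?_⟩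
  · rw [map_neg, ← e]; ring
  · rw [map_neg, ← f]; ring

theorem Ev.sub {a : Fin 7 → k} {z w : FractionRing (MvPolynomial (Fin 7) k)} {u v : k}
    (h1 : Ev a z u) (h2 : Ev a w v) : Ev a (z - w) (u - v) := by
  rw [sub_eq_add_neg, sub_eq_add_neg]
  exact h1.add h2.neg

theorem Ev.pow {a : Fin 7 → k} {z : FractionRing (MvPolynomial (Fin 7) k)} {u : k}
    (h1 : Ev a z u) (n : ℕ) : Ev a (z ^ n) (u ^ n) := by
  induction n with
  | zero =>
    have := Ev.const a (1 : k)
    rw [map_one] at this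
    simpa using this
  | succ n ih => rw [pow_succ, pow_succ]; exact ih.mul h1

theorem Ev.aeval {a : Fin 7 → k} {s : Fin 6 → FractionRing (MvPolynomial (Fin 7) k)}
    {v : Fin 6 → k} (h : ∀ i, Ev a (s i) (v i)) (P : MvPolynomial (Fin 6) k) :
    Ev a (MvPolynomial.aeval s P) (eval v P) := by
  induction P using MvPolynomial.induction_on with
  | C c => rw [aeval_C, eval_C]; exact Ev.const a c
  | add p q hp hq => rw [map_add, map_add]; exact hp.add hq
  | mul_X p i hp => rw [map_mul, map_mul, aeval_X, eval_X]; exact hp.mul (h i)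

theorem Ev.ne_zero {a : Fin 7 → k} {z : FractionRing (MvPolynomial (Fin 7) k)} {u : k}
    (h1 : Ev a z u) (hu : u ≠ 0) : z ≠ 0 := by
  obtain ⟨n, d, hd, e, f⟩ := h1
  rintro rfl
  rw [zero_mul, eq_comm, map_eq_zero_iff _ (IsFractionRing.injective _ _)] at e
  rw [e, map_zero] at f
  exact mul_ne_zero hu hd f

theorem Ev_transfer [Infinite k] (m : MvPolynomial (Fin 7) k) (hm : m ≠ 0)
    (z : FractionRing (MvPolynomial (Fin 7) k)) (h : ∀ a, eval a m ≠ 0 → Ev a z 0) : z = 0 := by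
  obtain ⟨n0, d0, hd0, rfl⟩ := IsFractionRing.div_surjective (A := MvPolynomial (Fin 7) k) z
  have hd0' : algebraMap _ (FractionRing (MvPolynomial (Fin 7) k)) d0 ≠ 0 := by
    rw [Ne, map_eq_zero_iff _ (IsFractionRing.injective _ _)]
    exact nonZeroDivisors.ne_zero hd0
  have : n0 * m = 0 := by
    apply MvPolynomial.funext
    intro a
    rw [map_mul, map_zero]
    by_cases ha : eval a m = 0
    · rw [ha, mul_zero]
    · obtain ⟨n, d, hd, e, f⟩ := h a ha
      have e' : n0 * d = n * d0 := by
        apply IsFractionRing.injective (MvPolynomial (Fin 7) k) (FractionRing (MvPolynomial (Fin 7) k))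
        rw [map_mul, map_mul, ← e]
        field_simp
      have e2 := congrArg (eval a) e'
      rw [map_mul, map_mul, ← f, zero_mul, zero_mul] at e2
      rw [(mul_eq_zero.mp e2).resolve_right hd, zero_mul]
  rw [(mul_eq_zero.mp this).resolve_right hm]
  simp

theorem Ev_sv (h3 : (3 : k) ≠ 0) (h5 : (5 : k) ≠ 0) {a : Fin 7 → k}
    {T1 T2 T3 : FractionRing (MvPolynomial (Fin 7) k)}
    {v1 v2 v3 : k} (e1 : Ev a T1 v1) (e2 : Ev a T2 v2) (e3 : Ev a T3 v3) (hv3 : v3 ≠ 0)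
    (i : Fin 6) : Ev a (sv T1 T2 T3 i) (sv v1 v2 v3 i) := by
  have h15 : (15 : k) ≠ 0 := by
    rw [show (15 : k) = 3 * 5 by norm_num]; exact mul_ne_zero h3 h5
  have h25 : (25 : k) ≠ 0 := by
    rw [show (25 : k) = 5 ^ 2 by norm_num]; exact pow_ne_zero _ h5
  have h75 : (75 : k) ≠ 0 := by
    rw [show (75 : k) = 3 * 5 ^ 2 by norm_num]; exact mul_ne_zero h3 (pow_ne_zero _ h5)
  have o := fun (n : ℕ) [n.AtLeastTwo] => Ev.ofNat a n
  fin_cases i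
  · exact Ev.zero a
  · exact (o 4).div e3 hv3
  · exact Ev.zero a
  · exact (((o 44).div (o 15) h15).add (((o 4).div (o 15) h15).mul e1)).div (e3.pow 2)
      (pow_ne_zero _ hv3)
  · exact (o 1024).div (e3.pow 2) (pow_ne_zero _ hv3)
  · exact ((((o 208).div (o 75) h75).sub (((o 16).div (o 75) h75).mul e1)).add
      (((o 1024).div (o 25) h25).mul e2)).div (e3.pow 3) (pow_ne_zero _ hv3)

end


theorem forward_incl {k : Type*} [Field k] [IsAlgClosed k]
    (h2 : (2 : k) ≠ 0) (h3 : (3 : k) ≠ 0) (h5 : (5 : k) ≠ 0)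
    (P2 P4 P6 P10 : MvPolynomial (Fin 7) k)
    (he2 : ∀ x y : Fin 6 → k, eval (sexticCoeff x y) P2 = I2r x y)
    (he4 : ∀ x y : Fin 6 → k, eval (sexticCoeff x y) P4 = I4r x y)
    (he6 : ∀ x y : Fin 6 → k, eval (sexticCoeff x y) P6 = I6r x y)
    (he10 : ∀ x y : Fin 6 → k, eval (sexticCoeff x y) P10 = I10r x y)
    (φ : MvPolynomial (Fin 7) k →+* FractionRing (MvPolynomial (Fin 7) k))
    (hφ : φ = algebraMap _ _)
    (u : FractionRing (MvPolynomial (Fin 7) k)) (hu : RatInvariant k u) :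
    ∃ N S : MvPolynomial (Fin 6) k,
      u = aeval (sv (φ P4 / (φ P2)^2) (φ P6 / (φ P2)^3) (φ P10 / (φ P2)^5)) S /
        (algebraMap k _ 720 *
          aeval (sv (φ P4 / (φ P2)^2) (φ P6 / (φ P2)^3) (φ P10 / (φ P2)^5)) N) := by
  subst hφ
  have : Infinite k := IsAlgClosed.instInfinite
  have hinj := IsFractionRing.injective (MvPolynomial (Fin 7) k)
    (FractionRing (MvPolynomial (Fin 7) k))
  have h720 : (720 : k) ≠ 0 := by
    rw [show (720 : k) = 2 ^ 4 * 3 ^ 2 * 5 by norm_num]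
    exact mul_ne_zero (mul_ne_zero (pow_ne_zero _ h2) (pow_ne_zero _ h3)) h5
  obtain ⟨p, q, hpq, hupq⟩ := IsFractionRing.exists_reduced_fraction (MvPolynomial (Fin 7) k) u
  have hq0 : (q : MvPolynomial (Fin 7) k) ≠ 0 := nonZeroDivisors.ne_zero q.2
  obtain ⟨q, hqm⟩ := q
  simp only at hpq hq0
  rw [IsFractionRing.mk'_eq_div] at hupq
  simp only at hupq
  have hq0' : algebraMap _ (FractionRing (MvPolynomial (Fin 7) k)) q ≠ 0 := by
    rw [Ne, map_eq_zero_iff _ hinj]; exact hq0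
  have huq : u * algebraMap _ (FractionRing (MvPolynomial (Fin 7) k)) q = algebraMap _ _ p := by
    rw [← hupq]; field_simp
  have H : ∀ g : GL (Fin 2) k, p * actRing k 6 (g : Matrix (Fin 2) (Fin 2) k) q =
      q * actRing k 6 (g : Matrix (Fin 2) (Fin 2) k) p := by
    intro g
    have := hu g p q huq
    apply hinj
    rw [map_mul, map_mul, ← this, ← huq]
    ring
  obtain ⟨N, S, hNS⟩ := symm_part p q
  set s := sv (algebraMap _ (FractionRing (MvPolynomial (Fin 7) k)) P4 / (algebraMap _ _ P2)^2)
    (algebraMap _ _ P6 / (algebraMap _ _ P2)^3) (algebraMap _ _ P10 / (algebraMap _ _ P2)^5) with hs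
  set m : MvPolynomial (Fin 7) k := X 0 * P2 * P10 * q with hmdef
  have hm : m ≠ 0 := mul_ne_zero (mul_ne_zero (mul_ne_zero (X_ne_zero _) (P2_ne h2 h3 P2 he2))
    (P10_ne h2 h3 h5 P10 he10)) hq0
  have key : ∀ a, eval a m ≠ 0 → ∃ v w : k, w ≠ 0 ∧ Ev a u v ∧
      Ev a (aeval s N) w ∧ Ev a (aeval s S) (720 * v * w) := by
    intro a ha
    simp only [hmdef, map_mul, eval_X] at ha
    have hqa := right_ne_zero_of_mul ha
    have ha := left_ne_zero_of_mul ha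
    have hP10 := right_ne_zero_of_mul ha
    have ha := left_ne_zero_of_mul ha
    have hP2 := right_ne_zero_of_mul ha
    have ha := left_ne_zero_of_mul ha
    obtain ⟨x, y, hxy⟩ := exists_roots a ha
    have f2 : eval a P2 = I2r x y := by rw [← hxy]; exact he2 x y
    have f4 : eval a P4 = I4r x y := by rw [← hxy]; exact he4 x y
    have f6 : eval a P6 = I6r x y := by rw [← hxy]; exact he6 x y
    have f10 : eval a P10 = I10r x y := by rw [← hxy]; exact he10 x y
    have hI : I2r x y ≠ 0 := by rwa [← f2]
    have hI10 : I10r x y ≠ 0 := by rwa [← f10]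
    have hD : sqrtDisc x y ≠ 0 := by
      intro h0
      apply hI10
      rw [← sqrtDisc_sq, h0]; simp
    set v : k := eval a p / eval a q with hv
    have hvq : v * eval a q = eval a p := by rw [hv]; field_simp
    have ht : I2r x y ^ 2 / sqrtDisc x y ≠ 0 := div_ne_zero (pow_ne_zero _ hI) hD
    obtain ⟨hN, hS⟩ := hNS (fun i => (I2r x y ^ 2 / sqrtDisc x y) * xi x y i) v
      (core_point h2 P10 he10 p q hq0 hpq H x y hD _ ht (by rwa [hxy]) v (by rwa [hxy]))
    rw [esv_xi h2 h3 h5 x y hD hI] at hN hS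
    have E2 : Ev a (algebraMap _ _ P2) (I2r x y) := by rw [← f2]; exact Ev.poly a P2
    have E4 : Ev a (algebraMap _ _ P4) (I4r x y) := by rw [← f4]; exact Ev.poly a P4
    have E6 : Ev a (algebraMap _ _ P6) (I6r x y) := by rw [← f6]; exact Ev.poly a P6
    have E10 : Ev a (algebraMap _ _ P10) (I10r x y) := by rw [← f10]; exact Ev.poly a P10
    have Es := Ev_sv h3 h5 (E4.div (E2.pow 2) (pow_ne_zero _ hI))
      (E6.div (E2.pow 3) (pow_ne_zero _ hI)) (E10.div (E2.pow 5) (pow_ne_zero _ hI))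
      (div_ne_zero hI10 (pow_ne_zero _ hI))
    refine ⟨v, _, hN, ⟨p, q, hqa, huq, hvq⟩, Ev.aeval Es N, ?_⟩
    rw [← hS]
    exact Ev.aeval Es S
  have hN0 : aeval s N ≠ 0 := by
    have : ∃ a, eval a m ≠ 0 := by
      by_contra hcon
      push Not at hcon
      apply hm
      apply MvPolynomial.funext
      simpa using hcon
    obtain ⟨a, ha⟩ := this
    obtain ⟨v, w, hw, -, h, -⟩ := key a ha
    exact h.ne_zero hw
  have hz : u * (algebraMap k _ 720 * aeval s N) - aeval s S = 0 := by
    apply Ev_transfer m hm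
    intro a ha
    obtain ⟨v, w, hw, e1, e2, e3⟩ := key a ha
    have := (e1.mul ((Ev.const a 720).mul e2)).sub e3
    rwa [show v * (720 * w) - 720 * v * w = 0 by ring] at this
  refine ⟨N, S, ?_⟩
  rw [eq_div_iff]
  · exact sub_eq_zero.mp hz
  · refine mul_ne_zero ?_ hN0
    rw [Ne, map_eq_zero]
    exact h720

theorem sv_mem {k K : Type*} [Field k] [Field K] [Algebra k K] (L : IntermediateField k K)
    (T1 T2 T3 : K) (h1 : T1 ∈ L) (h2 : T2 ∈ L) (h3 : T3 ∈ L) (i : Fin 6) : sv T1 T2 T3 i ∈ L := by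
  have o := fun (n : ℕ) [n.AtLeastTwo] => (ofNat_mem L n)
  fin_cases i
  · exact zero_mem L
  · exact div_mem (o 4) h3
  · exact zero_mem L
  · exact div_mem (add_mem (div_mem (o 44) (o 15)) (mul_mem (div_mem (o 4) (o 15)) h1))
      (pow_mem h3 2)
  · exact div_mem (o 1024) (pow_mem h3 2)
  · exact div_mem (add_mem (sub_mem (div_mem (o 208) (o 75)) (mul_mem (div_mem (o 16) (o 75)) h1))
      (mul_mem (div_mem (o 1024) (o 25)) h2)) (pow_mem h3 3)

theorem aeval_mem {k K : Type*} [Field k] [Field K] [Algebra k K] (L : IntermediateField k K)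
    (s : Fin 6 → K) (hs : ∀ i, s i ∈ L) (P : MvPolynomial (Fin 6) k) : aeval s P ∈ L := by
  induction P using MvPolynomial.induction_on with
  | C c => rw [aeval_C]; exact L.algebraMap_mem c
  | add p q hp hq => rw [map_add]; exact add_mem hp hq
  | mul_X p i hp => rw [map_mul, aeval_X]; exact mul_mem hp (hs i)

section
variable {k : Type*} [Field k] [Infinite k]

theorem ratInv_of (u : FractionRing (MvPolynomial (Fin 7) k))
    (h : ∀ g : GL (Fin 2) k, ∃ p q : MvPolynomial (Fin 7) k, q ≠ 0 ∧
      u * algebraMap _ (FractionRing (MvPolynomial (Fin 7) k)) q = algebraMap _ _ p ∧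
      u * algebraMap _ (FractionRing (MvPolynomial (Fin 7) k))
        (actRing k 6 (g : Matrix (Fin 2) (Fin 2) k) q) =
        algebraMap _ _ (actRing k 6 (g : Matrix (Fin 2) (Fin 2) k) p)) :
    RatInvariant k u := by
  intro g p' q' h'
  obtain ⟨p, q, hq, e, f⟩ := h g
  have hinj := IsFractionRing.injective (MvPolynomial (Fin 7) k)
    (FractionRing (MvPolynomial (Fin 7) k))
  have h1 : p * q' = p' * q := by
    apply hinj
    rw [map_mul, map_mul, ← e, ← h']
    ring
  have h2 := congrArg (fun P => algebraMap _ (FractionRing (MvPolynomial (Fin 7) k))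
    (actRing k 6 (g : Matrix (Fin 2) (Fin 2) k) P)) h1
  simp only [map_mul] at h2
  have h3 : algebraMap _ (FractionRing (MvPolynomial (Fin 7) k))
        (actRing k 6 (g : Matrix (Fin 2) (Fin 2) k) q) ≠ 0 := by
    rw [Ne, map_eq_zero_iff _ hinj]
    exact actRing_ne_zero g q hq
  rw [← f] at h2
  apply mul_right_cancel₀ h3
  rw [← h2]
  ring

theorem ratInv_out (u : FractionRing (MvPolynomial (Fin 7) k)) (hu : RatInvariant k u)
    (g : GL (Fin 2) k) : ∃ p q : MvPolynomial (Fin 7) k, q ≠ 0 ∧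
      u * algebraMap _ (FractionRing (MvPolynomial (Fin 7) k)) q = algebraMap _ _ p ∧
      u * algebraMap _ (FractionRing (MvPolynomial (Fin 7) k))
        (actRing k 6 (g : Matrix (Fin 2) (Fin 2) k) q) =
        algebraMap _ _ (actRing k 6 (g : Matrix (Fin 2) (Fin 2) k) p) := by
  obtain ⟨p, q, hq, e⟩ := IsFractionRing.div_surjective (A := MvPolynomial (Fin 7) k) u
  have hq0 := nonZeroDivisors.ne_zero hq
  have hinj := IsFractionRing.injective (MvPolynomial (Fin 7) k)
    (FractionRing (MvPolynomial (Fin 7) k))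
  have hq' : algebraMap _ (FractionRing (MvPolynomial (Fin 7) k)) q ≠ 0 := by
    rw [Ne, map_eq_zero_iff _ hinj]
    exact hq0
  have e' : u * algebraMap _ (FractionRing (MvPolynomial (Fin 7) k)) q = algebraMap _ _ p := by
    rw [← e]; field_simp
  exact ⟨p, q, hq0, e', hu g p q e'⟩

theorem ratInv_algebraMap (c : k) : RatInvariant k (algebraMap k _ c) := by
  apply ratInv_of
  intro g
  refine ⟨C c, 1, one_ne_zero, ?_, ?_⟩
  · rw [map_one, mul_one, IsScalarTower.algebraMap_apply k (MvPolynomial (Fin 7) k)]; rfl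
  · rw [map_one, map_one, mul_one, IsScalarTower.algebraMap_apply k (MvPolynomial (Fin 7) k)]
    congr 1
    exact ((actRing k 6 (g : Matrix (Fin 2) (Fin 2) k)).commutes c).symm

theorem ratInv_add (u v : FractionRing (MvPolynomial (Fin 7) k)) (hu : RatInvariant k u)
    (hv : RatInvariant k v) : RatInvariant k (u + v) := by
  apply ratInv_of
  intro g
  obtain ⟨p, q, hq, e, f⟩ := ratInv_out u hu g
  obtain ⟨p', q', hq', e', f'⟩ := ratInv_out v hv g
  refine ⟨p * q' + p' * q, q * q', mul_ne_zero hq hq', ?_, ?_⟩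
  · simp only [map_mul, map_add, ← e, ← e']; ring
  · simp only [map_mul, map_add, ← f, ← f']; ring

theorem ratInv_mul (u v : FractionRing (MvPolynomial (Fin 7) k)) (hu : RatInvariant k u)
    (hv : RatInvariant k v) : RatInvariant k (u * v) := by
  apply ratInv_of
  intro g
  obtain ⟨p, q, hq, e, f⟩ := ratInv_out u hu g
  obtain ⟨p', q', hq', e', f'⟩ := ratInv_out v hv g
  refine ⟨p * p', q * q', mul_ne_zero hq hq', ?_, ?_⟩
  · simp only [map_mul, ← e, ← e']; ring
  · simp only [map_mul, ← f, ← f']; ring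

theorem ratInv_inv (u : FractionRing (MvPolynomial (Fin 7) k)) (hu : RatInvariant k u) :
    RatInvariant k u⁻¹ := by
  by_cases h0 : u = 0
  · rw [h0, inv_zero, ← h0]; exact hu
  apply ratInv_of
  intro g
  obtain ⟨p, q, hq, e, f⟩ := ratInv_out u hu g
  refine ⟨q, p, ?_, ?_, ?_⟩
  · rintro rfl
    rw [map_zero, mul_eq_zero, map_eq_zero_iff _ (IsFractionRing.injective _ _)] at e
    tauto
  · rw [← e, inv_mul_cancel_left₀ h0]
  · rw [← f, inv_mul_cancel_left₀ h0]

end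

theorem eval_smul_homog {k : Type*} [Field k] (P : MvPolynomial (Fin 7) k) (d : ℕ)
    (hP : P.IsHomogeneous d) (c : k) (a : Fin 7 → k) : eval (c • a) P = c ^ d * eval a P := by
  rw [eval_eq, eval_eq, Finset.mul_sum]
  refine Finset.sum_congr rfl fun m hm => ?_
  have hd : ∑ i ∈ m.support, m i = d := by
    have := hP (mem_support_iff.mp hm)
    simpa [Finsupp.weight_apply, Finsupp.sum] using this
  simp only [Pi.smul_apply, smul_eq_mul, mul_pow, Finset.prod_mul_distrib]
  rw [Finset.prod_pow_eq_pow_sum, hd]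
  ring

theorem actRing_inv {k : Type*} [Field k] [IsAlgClosed k] (P : MvPolynomial (Fin 7) k) (d : ℕ)
    (hP : P.IsHomogeneous d) (hi : SL2Invariant k 6 P) (g : Matrix (Fin 2) (Fin 2) k) (l : k)
    (hl : l ≠ 0) (hg : l ^ 2 = g.det) :
    actRing k 6 g P = C ((l ^ 6) ^ d) * P := by
  have : Infinite k := IsAlgClosed.instInfinite
  apply MvPolynomial.funext
  intro a
  rw [eval_actRing, map_mul, eval_C]
  have hdet : (l⁻¹ • g).det = 1 := by
    rw [Matrix.det_smul, ← hg]
    simp [hl]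
  have hg1 : g = l • (l⁻¹ • g) := by rw [smul_inv_smul₀ hl]
  have h := hi ⟨l⁻¹ • g, hdet⟩ a
  change eval (actCoeff k 6 (l⁻¹ • g) a) P = _ at h
  rw [hg1, actCoeff_smul, eval_smul_homog P d hP, h]

theorem ratInv_T {k : Type*} [Field k] [IsAlgClosed k] (P P2 : MvPolynomial (Fin 7) k) (d : ℕ)
    (hP : P.IsHomogeneous (2 * d)) (hi : SL2Invariant k 6 P) (hP2 : P2.IsHomogeneous 2)
    (hi2 : SL2Invariant k 6 P2) (h0 : P2 ≠ 0) :
    RatInvariant k (algebraMap _ (FractionRing (MvPolynomial (Fin 7) k)) P /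
      (algebraMap _ _ P2) ^ d) := by
  have : Infinite k := IsAlgClosed.instInfinite
  apply ratInv_of
  intro g
  obtain ⟨l, hl⟩ := IsAlgClosed.exists_pow_nat_eq (g : Matrix (Fin 2) (Fin 2) k).det
    (n := 2) (by norm_num)
  have hdet : (g : Matrix (Fin 2) (Fin 2) k).det ≠ 0 := g.det.ne_zero
  have hl0 : l ≠ 0 := by
    rintro rfl
    apply hdet
    rw [← hl]; simp
  have hP2' : algebraMap _ (FractionRing (MvPolynomial (Fin 7) k)) P2 ≠ 0 := by
    rw [Ne, map_eq_zero_iff _ (IsFractionRing.injective _ _)]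
    exact h0
  refine ⟨P, P2 ^ d, pow_ne_zero _ h0, ?_, ?_⟩
  · rw [map_pow]; field_simp
  · rw [map_pow, actRing_inv P _ hP hi _ l hl0 hl, actRing_inv P2 _ hP2 hi2 _ l hl0 hl]
    simp only [map_mul, map_pow, mul_pow]
    field_simp
    ring

/-- The field of `GL₂(k)`-invariant rational functions on the space of binary sextics is
the rational function field `k(T₁, T₂, T₃)`, where `T₁ = I₄/I₂²`, `T₂ = I₆/I₂³`,
`T₃ = I₁₀/I₂⁵`. -/
theorem invariant_function_field_of_sextics
    (k : Type*) [Field k] [IsAlgClosed k]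
    (h2 : (2 : k) ≠ 0) (h3 : (3 : k) ≠ 0) (h5 : (5 : k) ≠ 0)
    (P2 P4 P6 P10 : MvPolynomial (Fin 7) k)
    (hh2 : P2.IsHomogeneous 2) (hh4 : P4.IsHomogeneous 4)
    (hh6 : P6.IsHomogeneous 6) (hh10 : P10.IsHomogeneous 10)
    (hi2 : SL2Invariant k 6 P2) (hi4 : SL2Invariant k 6 P4)
    (hi6 : SL2Invariant k 6 P6) (hi10 : SL2Invariant k 6 P10)
    (he2 : ∀ x y : Fin 6 → k, eval (sexticCoeff x y) P2 = I2r x y)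
    (he4 : ∀ x y : Fin 6 → k, eval (sexticCoeff x y) P4 = I4r x y)
    (he6 : ∀ x y : Fin 6 → k, eval (sexticCoeff x y) P6 = I6r x y)
    (he10 : ∀ x y : Fin 6 → k, eval (sexticCoeff x y) P10 = I10r x y) :
    letI F := FractionRing (MvPolynomial (Fin 7) k)
    letI φ := algebraMap (MvPolynomial (Fin 7) k) F
    {u : F | RatInvariant k u} =
      (IntermediateField.adjoin k
        ({φ P4 / (φ P2)^2, φ P6 / (φ P2)^3, φ P10 / (φ P2)^5} : Set F) :
        IntermediateField k F) := by
  have : Infinite k := IsAlgClosed.instInfinite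
  have hP2 := P2_ne h2 h3 P2 he2
  ext u
  constructor
  · intro hu
    obtain ⟨N, S, h⟩ := forward_incl h2 h3 h5 P2 P4 P6 P10 he2 he4 he6 he10 _ rfl u hu
    rw [SetLike.mem_coe, h]
    have hs := sv_mem (IntermediateField.adjoin k
        ({algebraMap _ (FractionRing (MvPolynomial (Fin 7) k)) P4 / (algebraMap _ _ P2)^2,
          algebraMap _ _ P6 / (algebraMap _ _ P2)^3,
          algebraMap _ _ P10 / (algebraMap _ _ P2)^5} :
          Set (FractionRing (MvPolynomial (Fin 7) k)))) _ _ _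
      (IntermediateField.subset_adjoin k _ (Set.mem_insert _ _))
      (IntermediateField.subset_adjoin k _ (Set.mem_insert_of_mem _ (Set.mem_insert _ _)))
      (IntermediateField.subset_adjoin k _
        (Set.mem_insert_of_mem _ (Set.mem_insert_of_mem _ (Set.mem_singleton _))))
    exact div_mem (aeval_mem _ _ hs S) (mul_mem (IntermediateField.algebraMap_mem _ _)
      (aeval_mem _ _ hs N))
  · intro hu
    change RatInvariant k u
    induction hu using IntermediateField.adjoin_induction with
    | mem x hx =>
      rcases hx with rfl | rfl | rfl
      · exact ratInv_T P4 P2 2 hh4 hi4 hh2 hi2 hP2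
      · exact ratInv_T P6 P2 3 hh6 hi6 hh2 hi2 hP2
      · exact ratInv_T P10 P2 5 hh10 hi10 hh2 hi2 hP2
    | algebraMap x => exact ratInv_algebraMap x
    | add x y _ _ hx hy => exact ratInv_add x y hx hy
    | inv x _ hx => exact ratInv_inv x hx
    | mul x y _ _ hx hy => exact ratInv_mul x y hx hy
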